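/- arXiv:1311.5667 — 2 statements merged into one kernel-verified Lean document; each statement's English description precedes it below -/
import Mathlib

section
/- Leading-order form, Case II-2: if m = 2m'+1 is an odd integer with m' > 0, ε = 1 and δ = −1, then lim_{Δr→0⁺} Δr^{−(m+1)}·⟨A⟩(Δr) = L, where L := −(β/2^{m+1})·(v²·Ĉ_ρ(ρ)/D)·[ Σ_{p=0}^{m'} C(m,2p)·X_{1,0}^{2p}·X_{0,1}^{2(m'−p)+1}·(Y^{(1)}_{1,0} − Y^{(2)}_{1,0}) + Σ_{p=0}^{m'} C(m,2p+1)·X_{1,0}^{2p+1}·X_{0,1}^{2(m'−p)}·(Y^{(1)}_{0,1} − Y^{(2)}_{0,1}) ] − (m·β/2^{m+1})·(v²·Ĉ(ρ)/D)·[ Σ_{p=0}^{m'} C(m−1,2p)·X_{1,0}^{2p}·X_{0,1}^{2(m'−p)}·(X^{(1)}_{1,1} − X^{(2)}_{1,1}) + Σ_{p=0}^{m'−1} C(m−1,2p+1)·X_{1,0}^{2p+1}·X_{0,1}^{2(m'−p)−1}·( X^{(1)}_{0,2} + X^{(1)}_{2,0} − X^{(2)}_{0,2} − X^{(2)}_{2,0}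 ) ] + (v/2^{m+1})·{ β·Σ_{p=0}^{m'} C(m,2p)·X_{1,0}^{2p}·X_{0,1}^{2(m'−p)+1}·[ Ĉ_ρ(ρ)·(Y^{(1)}_{1,1} − Y^{(2)}_{1,1}) + Ĉ_ρρ(ρ)·(Y^{(1)}_{0,1}·Y^{(1)}_{1,0} − Y^{(2)}_{0,1}·Y^{(2)}_{1,0}) ] + Σ_{p=0}^{m'} C(m,2p+1)·X_{1,0}^{2p+1}·X_{0,1}^{2(m'−p)}·[ Ĉ_ρ(ρ)·( β·Y^{(1)}_{0,2} + Y^{(1)}_{2,0}·S_ν(2(m'−p)) − β·Y^{(2)}_{0,2} − Y^{(2)}_{2,0}·S_ν(2(m'−p)) ) + (1/2)·Ĉ_ρρ(ρ)·( β·(Y^{(1)}_{0,1})² + (Y^{(1)}_{1,0})²·S_ν(2(m'−p)) − β·(Y^{(2)}_{0,1})² − (Y^{(2)}_{1,0})²·S_ν(2(m'−p)) ) ] } + (m·v/2^{m+1})·{ Σ_{p=0}^{m'} C(m−1,2p)·X_{1,0}^{2p}·X_{0,1}^{2(m'−p)}·[ Ĉ_ρ(ρ)·( β·X^{(1)}_{0,2}·Y^{(1)}_{1,0}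 + β·X^{(1)}_{1,1}·Y^{(1)}_{0,1} + X^{(1)}_{2,0}·Y^{(1)}_{1,0}·S_ν(2(m'−p)) − ( β·X^{(2)}_{0,2}·Y^{(2)}_{1,0} + β·X^{(2)}_{1,1}·Y^{(2)}_{0,1} + X^{(2)}_{2,0}·Y^{(2)}_{1,0}·S_ν(2(m'−p)) ) ) + Ĉ(ρ)·( β·X^{(1)}_{1,2} + X^{(1)}_{3,0}·S_ν(2(m'−p)) − ( β·X^{(2)}_{1,2} + X^{(2)}_{3,0}·S_ν(2(m'−p)) ) ) ] + β·Σ_{p=0}^{m'−1} C(m−1,2p+1)·X_{1,0}^{2p+1}·X_{0,1}^{2(m'−p)−1}·[ Ĉ_ρ(ρ)·( X^{(1)}_{0,2}·Y^{(1)}_{0,1} + X^{(1)}_{1,1}·Y^{(1)}_{1,0} + X^{(1)}_{2,0}·Y^{(1)}_{0,1} − ( X^{(2)}_{0,2}·Y^{(2)}_{0,1} + X^{(2)}_{1,1}·Y^{(2)}_{1,0} + X^{(2)}_{2,0}·Y^{(2)}_{0,1} ) ) + Ĉ(ρ)·( X^{(1)}_{2,1} + X^{(1)}_{0,3} − X^{(2)}_{2,1}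 − X^{(2)}_{0,3} ) ] } + (m(m−1)/2^{m+2})·v·Ĉ(ρ)·[ 2β·Σ_{p=0}^{m'−1} C(m−2,2p)·X_{1,0}^{2p}·X_{0,1}^{2(m'−p)−1}·( X^{(1)}_{0,2}·X^{(1)}_{1,1} + X^{(1)}_{1,1}·X^{(1)}_{2,0} − X^{(2)}_{0,2}·X^{(2)}_{1,1} − X^{(2)}_{1,1}·X^{(2)}_{2,0} ) + Σ_{p=0}^{m'−1} C(m−2,2p+1)·X_{1,0}^{2p+1}·X_{0,1}^{2(m'−p−1)}·( β·(X^{(1)}_{0,2})² + 2β·X^{(1)}_{0,2}·X^{(1)}_{2,0} + β·(X^{(1)}_{1,1})² + (X^{(1)}_{2,0})²·S_ν(2(m'−p−1)) − ( β·(X^{(2)}_{0,2})² + 2β·X^{(2)}_{0,2}·X^{(2)}_{2,0} + β·(X^{(2)}_{1,1})² + (X^{(2)}_{2,0})²·S_ν(2(m'−p−1)) ) ) ]. -/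
open Filter Finset

noncomputable section

/-- Transition probability η on trits: η(0) = (β/2)(1 − Pe/2), η(1) = 1 − β,
η(2) = (β/2)(1 + Pe/2). -/
def eta (β Pe : ℝ) (ω : Fin 3) : ℝ :=
  if (ω : ℕ) = 0 then β / 2 * (1 - Pe / 2)
  else if (ω : ℕ) = 1 then 1 - β
  else β / 2 * (1 + Pe / 2)

/-- ν(ω) = η(2 − ω). -/
def nu (β Pe : ℝ) (ω : Fin 3) : ℝ :=
  if (ω : ℕ) = 0 then β / 2 * (1 + Pe / 2)
  else if (ω : ℕ) = 1 then 1 - β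
  else β / 2 * (1 - Pe / 2)

/-- Bulk local density ρ̂ⱼ(u′) = (∏ η(u_d)/ν(u_d)) · ρ₀(r + (j + Σ (1 − u_d))·Δr). -/
def rhoHat (β Pe r Δr : ℝ) (ρ₀ : ℝ → ℝ) {K : ℕ} (j : ℤ) (u : Fin K → Fin 3) : ℝ :=
  (∏ d, eta β Pe (u d) / nu β Pe (u d)) *
    ρ₀ (r + ((j : ℝ) + ∑ d, (1 - ((u d : ℕ) : ℝ))) * Δr)

/-- F_j(ω, u) with u = u₀u′ :
F_j(ω,u) = f((η(ω)/ν(ω))·ρ̂_j(u′), (η(u₀)/ν(u₀))·ρ̂_{j+1−u₀}(u′)). -/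
def Floc (β Pe r Δr : ℝ) (ρ₀ : ℝ → ℝ) (f : ℝ → ℝ → ℝ) {K : ℕ}
    (j : ℤ) (ω u₀ : Fin 3) (u' : Fin K → Fin 3) : ℝ :=
  f (eta β Pe ω / nu β Pe ω * rhoHat β Pe r Δr ρ₀ j u')
    (eta β Pe u₀ / nu β Pe u₀ * rhoHat β Pe r Δr ρ₀ (j + 1 - ((u₀ : ℕ) : ℤ)) u')

/-- K(Δr): the sum over the trit ω and the k-digit trit string u = u₀u′. -/
def Ksum (D v β r : ℝ) (k : ℕ) (ρ₀ : ℝ → ℝ) (f : ℝ → ℝ → ℝ)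
    (ε δ : ℝ) (m : ℕ) (Δr : ℝ) : ℝ :=
  Δr * ∑ ω : Fin 3, ∑ u₀ : Fin 3, ∑ u' : Fin (k - 1) → Fin 3,
    (eta β (v * Δr / D) ω + δ * nu β (v * Δr / D) ω) *
      (nu β (v * Δr / D) u₀ * ∏ d, nu β (v * Δr / D) (u' d)) *
      (Floc β (v * Δr / D) r Δr ρ₀ f 0 ω u₀ u' +
        ε * (-1 : ℝ) ^ m * Floc β (v * Δr / D) r Δr ρ₀ f (1 - ((ω : ℕ) : ℤ)) ω u₀ u')

/-- The spatio-temporally averaged T¹-type quantity ⟨A⟩(Δr) = K/(τ·Δr),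
with τ = β·Δr²/(2D). -/
def avgA (D v β r : ℝ) (k : ℕ) (ρ₀ : ℝ → ℝ) (f : ℝ → ℝ → ℝ)
    (ε δ : ℝ) (m : ℕ) (Δr : ℝ) : ℝ :=
  Ksum D v β r k ρ₀ f ε δ m Δr / (β * Δr ^ 2 / (2 * D) * Δr)

/-- f̃(X,Y) = f(Y + X, Y − X). -/
def ftilde (f : ℝ → ℝ → ℝ) (X Y : ℝ) : ℝ := f (Y + X) (Y - X)

set_option linter.unusedVariables false in
/-- The limit value L of Δr^(−(m+1))·⟨A⟩(Δr) in Case II-2 (m = 2m′+1 odd, m′ > 0,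
ε = 1, δ = −1), expressed through the leading-order constants X_{p,q}, Y^{(i)}_{p,q},
S_ν and the derivatives of Ĉ at ρ = ρ₀(r). -/
def LII2 (D v β r : ℝ) (ρ₀ Chat : ℝ → ℝ) (m m' : ℕ) : ℝ :=
  let ρ := ρ₀ r;
  let ρr := deriv ρ₀ r;
  let ρrr := iteratedDeriv 2 ρ₀ r;
  let ρrrr := iteratedDeriv 3 ρ₀ r;
  let X10 := v / D * ρ;
  let X01 := -(v / D) * ρ + ρr;
  let Y110 := v / D * ρ;
  let Y210 := v / D * ρ - 2 * ρr;
  let Y101 := v / D * ρ - ρr;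
  let Y201 := v / D * ρ - ρr;
  let X120 := (v / D) ^ 2 * ρ;
  let X220 := (v / D) ^ 2 * ρ - 2 * (v / D) * ρr;
  let X111 := (0 : ℝ);
  let X211 := 2 * (v / D) * ρr - 2 * ρrr;
  let X102 := -(v / D) ^ 2 * ρ + 2 * (v / D) * ρr - ρrr;
  let X202 := -(v / D) ^ 2 * ρ + 2 * (v / D) * ρr - ρrr;
  let Y120 := (v / D) ^ 2 * ρ;
  let Y220 := (v / D) ^ 2 * ρ - 2 * (v / D) * ρr + 2 * ρrr;
  let Y111 := (0 : ℝ);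
  let Y211 := -(2 * (v / D) * ρr) + 2 * ρrr;
  let Y102 := (v / D) ^ 2 * ρ - 2 * (v / D) * ρr + ρrr;
  let Y202 := (v / D) ^ 2 * ρ - 2 * (v / D) * ρr + ρrr;
  let X130 := (v / D) ^ 3 * ρ;
  let X230 := (v / D) ^ 3 * ρ - 2 * (v / D) ^ 2 * ρr + 2 * (v / D) * ρrr;
  let X121 := (0 : ℝ);
  let X221 := -(2 * (v / D) * ρrr) + 2 * ρrrr;
  let X112 := (0 : ℝ);
  let X212 := 2 * (v / D) ^ 2 * ρr - 4 * (v / D) * ρrr + 2 * ρrrr;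
  let X103 := -(v / D) ^ 3 * ρ + 2 * (v / D) ^ 2 * ρr - 2 * (v / D) * ρrr + 2 / 3 * ρrrr;
  let X203 := -(v / D) ^ 3 * ρ + 2 * (v / D) ^ 2 * ρr - 2 * (v / D) * ρrr + 2 / 3 * ρrrr;
  let Snu : ℕ → ℝ := fun a => if a = 0 then (1 : ℝ) else β;
  let Cd := deriv Chat ρ;
  let Cdd := iteratedDeriv 2 Chat ρ;
  -(β / 2 ^ (m + 1)) * (v ^ 2 * Cd / D) *
      ((∑ p ∈ Finset.range (m' + 1),
          ((m.choose (2 * p) : ℝ) * X10 ^ (2 * p) * X01 ^ (2 * (m' - p) + 1) *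
            (Y110 - Y210)))
        + (∑ p ∈ Finset.range (m' + 1),
          ((m.choose (2 * p + 1) : ℝ) * X10 ^ (2 * p + 1) * X01 ^ (2 * (m' - p)) *
            (Y101 - Y201))))
    - (m : ℝ) * β / 2 ^ (m + 1) * (v ^ 2 * Chat ρ / D) *
      ((∑ p ∈ Finset.range (m' + 1),
          (((m - 1).choose (2 * p) : ℝ) * X10 ^ (2 * p) * X01 ^ (2 * (m' - p)) *
            (X111 - X211)))
        + (∑ p ∈ Finset.range m',
          (((m - 1).choose (2 * p + 1) : ℝ) * X10 ^ (2 * p + 1) * X01 ^ (2 * (m' - p) - 1) *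
            (X102 + X120 - X202 - X220))))
    + v / 2 ^ (m + 1) *
      (β * (∑ p ∈ Finset.range (m' + 1),
          ((m.choose (2 * p) : ℝ) * X10 ^ (2 * p) * X01 ^ (2 * (m' - p) + 1) *
            (Cd * (Y111 - Y211) + Cdd * (Y101 * Y110 - Y201 * Y210))))
        + (∑ p ∈ Finset.range (m' + 1),
          ((m.choose (2 * p + 1) : ℝ) * X10 ^ (2 * p + 1) * X01 ^ (2 * (m' - p)) *
            (Cd * (β * Y102 + Y120 * Snu (2 * (m' - p)) - β * Y202 -
                Y220 * Snu (2 * (m' - p))) +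
              1 / 2 * Cdd * (β * Y101 ^ 2 + Y110 ^ 2 * Snu (2 * (m' - p)) - β * Y201 ^ 2 -
                Y210 ^ 2 * Snu (2 * (m' - p)))))))
    + (m : ℝ) * v / 2 ^ (m + 1) *
      ((∑ p ∈ Finset.range (m' + 1),
          (((m - 1).choose (2 * p) : ℝ) * X10 ^ (2 * p) * X01 ^ (2 * (m' - p)) *
            (Cd * (β * X102 * Y110 + β * X111 * Y101 + X120 * Y110 * Snu (2 * (m' - p)) -
                (β * X202 * Y210 + β * X211 * Y201 + X220 * Y210 * Snu (2 * (m' - p)))) +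
              Chat ρ * (β * X112 + X130 * Snu (2 * (m' - p)) -
                (β * X212 + X230 * Snu (2 * (m' - p)))))))
        + β * (∑ p ∈ Finset.range m',
          (((m - 1).choose (2 * p + 1) : ℝ) * X10 ^ (2 * p + 1) * X01 ^ (2 * (m' - p) - 1) *
            (Cd * (X102 * Y101 + X111 * Y110 + X120 * Y101 -
                (X202 * Y201 + X211 * Y210 + X220 * Y201)) +
              Chat ρ * (X121 + X103 - X221 - X203)))))
    + (m : ℝ) * ((m : ℝ) - 1) / 2 ^ (m + 2) * v * Chat ρ *
      (2 * β * (∑ p ∈ Finset.range m',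
          (((m - 2).choose (2 * p) : ℝ) * X10 ^ (2 * p) * X01 ^ (2 * (m' - p) - 1) *
            (X102 * X111 + X111 * X120 - X202 * X211 - X211 * X220)))
        + (∑ p ∈ Finset.range m',
          (((m - 2).choose (2 * p + 1) : ℝ) * X10 ^ (2 * p + 1) * X01 ^ (2 * (m' - p - 1)) *
            (β * X102 ^ 2 + 2 * β * X102 * X120 + β * X111 ^ 2 +
                X120 ^ 2 * Snu (2 * (m' - p - 1)) -
              (β * X202 ^ 2 + 2 * β * X202 * X220 + β * X211 ^ 2 +
                X220 ^ 2 * Snu (2 * (m' - p - 1)))))))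

/-- `φ h = c₀ + c₁ h + c₂ h² + o(h²)` as `h → 0⁺`. -/
def HasJetTwo (φ : ℝ → ℝ) (c₀ c₁ c₂ : ℝ) : Prop :=
  ∃ e : ℝ → ℝ, Tendsto e (nhdsWithin 0 (Set.Ioi 0)) (nhds 0) ∧
    ∀ᶠ h in nhdsWithin 0 (Set.Ioi 0), φ h = c₀ + c₁ * h + c₂ * h ^ 2 + h ^ 2 * e h

/-- `φ h = c₀ + c₁ h + c₂ h² + c₃ h³ + o(h³)` as `h → 0⁺`. -/
def HasJetThree (φ : ℝ → ℝ) (c₀ c₁ c₂ c₃ : ℝ) : Prop :=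
  ∃ e : ℝ → ℝ, Tendsto e (nhdsWithin 0 (Set.Ioi 0)) (nhds 0) ∧
    ∀ᶠ h in nhdsWithin 0 (Set.Ioi 0),
      φ h = c₀ + c₁ * h + c₂ * h ^ 2 + c₃ * h ^ 3 + h ^ 3 * e h

theorem tendsto_id_nhdsGT_zero : Tendsto (fun h : ℝ => h) (nhdsWithin 0 (Set.Ioi 0)) (nhds 0) :=
  tendsto_nhdsWithin_of_tendsto_nhds tendsto_id

/-- Taylor's theorem at `x₀` with Peano remainder, in the increment variable. -/
theorem exists_taylor_peano {g : ℝ → ℝ} {n : ℕ} (hg : ContDiff ℝ n g) (x₀ : ℝ) :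
    ∃ E : ℝ → ℝ, Tendsto E (nhds 0) (nhds 0) ∧ ∀ h, g (x₀ + h) =
      (∑ i ∈ Finset.range (n + 1), iteratedDeriv i g x₀ / (i.factorial : ℝ) * h ^ i)
        + h ^ n * E h := by
  have hO := taylor_isLittleO_univ (x₀ := x₀) hg
  obtain ⟨E, hE, hEeq⟩ := hO.exists_eq_mul
  classical
  refine ⟨fun h => if h = 0 then 0 else
    (g (x₀ + h) - ∑ i ∈ Finset.range (n + 1),
      iteratedDeriv i g x₀ / (i.factorial : ℝ) * h ^ i) / h ^ n, ?_, ?_⟩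
  · have hshift : Tendsto (fun h : ℝ => x₀ + h) (nhds 0) (nhds x₀) := by
      have : Continuous fun h : ℝ => x₀ + h := by fun_prop
      simpa using this.tendsto 0
    have h1 := (hE.comp hshift).norm
    have h2 := hshift.eventually hEeq
    refine squeeze_zero_norm' ?_ (by simpa using h1)
    filter_upwards [h2] with h hh
    split_ifs with h0
    · simp
    · have hs : taylorWithinEval g n Set.univ x₀ (x₀ + h) =
          ∑ i ∈ Finset.range (n + 1), iteratedDeriv i g x₀ / (i.factorial : ℝ) * h ^ i := by
        rw [taylor_within_apply]
        refine Finset.sum_congr rfl fun i _ => ?_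
        rw [iteratedDerivWithin_univ, smul_eq_mul]
        ring
      rw [← hs]
      simp only [Pi.mul_apply] at hh
      rw [hh]
      have : h ^ n ≠ 0 := pow_ne_zero _ h0
      simp [this]
  · intro h
    by_cases h0 : h = 0
    · subst h0
      simp [Finset.sum_range_succ']
    · have : h ^ n ≠ 0 := pow_ne_zero _ h0
      simp only [h0, if_false]
      field_simp
      ring

namespace HasJetTwo

variable {φ ψ : ℝ → ℝ} {a₀ a₁ a₂ b₀ b₁ b₂ : ℝ}

theorem congr' (hφ : HasJetTwo φ a₀ a₁ a₂)
    (h : ∀ᶠ x in nhdsWithin 0 (Set.Ioi 0), ψ x = φ x) : HasJetTwo ψ a₀ a₁ a₂ := by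
  obtain ⟨e, he, hφ⟩ := hφ
  exact ⟨e, he, by filter_upwards [hφ, h] with x h1 h2; rw [h2, h1]⟩

theorem tendsto (hφ : HasJetTwo φ a₀ a₁ a₂) :
    Tendsto φ (nhdsWithin 0 (Set.Ioi 0)) (nhds a₀) := by
  obtain ⟨e, he, hφ⟩ := hφ
  have hh := tendsto_id_nhdsGT_zero
  refine Tendsto.congr' (EventuallyEq.symm hφ) ?_
  simpa using ((tendsto_const_nhds (x := a₀)).add (hh.const_mul a₁)).add
    ((hh.pow 2).const_mul a₂) |>.add ((hh.pow 2).mul he)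

theorem add (hφ : HasJetTwo φ a₀ a₁ a₂) (hψ : HasJetTwo ψ b₀ b₁ b₂) :
    HasJetTwo (fun h => φ h + ψ h) (a₀ + b₀) (a₁ + b₁) (a₂ + b₂) := by
  obtain ⟨e, he, hφ⟩ := hφ
  obtain ⟨e', he', hψ⟩ := hψ
  refine ⟨fun h => e h + e' h, by simpa using he.add he', ?_⟩
  filter_upwards [hφ, hψ] with h h1 h2
  rw [h1, h2]; ring

theorem const_mul (hφ : HasJetTwo φ a₀ a₁ a₂) (c : ℝ) :
    HasJetTwo (fun h => c * φ h) (c * a₀) (c * a₁) (c * a₂) := by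
  obtain ⟨e, he, hφ⟩ := hφ
  refine ⟨fun h => c * e h, by simpa using he.const_mul c, ?_⟩
  filter_upwards [hφ] with h h1
  rw [h1]; ring

theorem mul (hφ : HasJetTwo φ a₀ a₁ a₂) (hψ : HasJetTwo ψ b₀ b₁ b₂) :
    HasJetTwo (fun h => φ h * ψ h) (a₀ * b₀) (a₀ * b₁ + a₁ * b₀)
      (a₀ * b₂ + a₁ * b₁ + a₂ * b₀) := by
  have hψt := hψ.tendsto
  obtain ⟨e, he, hφ⟩ := hφ
  obtain ⟨e', he', hψ⟩ := hψ
  have hh := tendsto_id_nhdsGT_zero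
  refine ⟨fun h => h * (a₁ * b₂ + a₂ * b₁ + a₂ * b₂ * h) + (a₀ + a₁ * h + a₂ * h ^ 2) * e' h
    + e h * ψ h, ?_, ?_⟩
  · have t1 : Tendsto (fun h : ℝ => h * (a₁ * b₂ + a₂ * b₁ + a₂ * b₂ * h))
        (nhdsWithin 0 (Set.Ioi 0)) (nhds 0) := by
      simpa using hh.mul ((tendsto_const_nhds (x := a₁ * b₂ + a₂ * b₁)).add
        (hh.const_mul (a₂ * b₂)))
    have t2 : Tendsto (fun h : ℝ => (a₀ + a₁ * h + a₂ * h ^ 2) * e' h)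
        (nhdsWithin 0 (Set.Ioi 0)) (nhds 0) := by
      simpa using (((tendsto_const_nhds (x := a₀)).add (hh.const_mul a₁)).add
        ((hh.pow 2).const_mul a₂)).mul he'
    simpa using (t1.add t2).add (he.mul hψt)
  · filter_upwards [hφ, hψ] with h h1 h2
    rw [h1, h2]; ring

theorem comp {g : ℝ → ℝ} (hg : ContDiff ℝ 2 g) (hφ : HasJetTwo φ a₀ a₁ a₂) :
    HasJetTwo (fun h => g (φ h)) (g a₀) (deriv g a₀ * a₁)
      (deriv g a₀ * a₂ + iteratedDeriv 2 g a₀ / 2 * a₁ ^ 2) := by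
  obtain ⟨E, hE, hEeq⟩ := exists_taylor_peano (n := 2) hg a₀
  have hφt := hφ.tendsto
  obtain ⟨e, he, hφ⟩ := hφ
  have hh := tendsto_id_nhdsGT_zero
  have hq : Tendsto (fun h : ℝ => a₁ + a₂ * h + h * e h)
      (nhdsWithin 0 (Set.Ioi 0)) (nhds a₁) := by
    simpa using ((tendsto_const_nhds (x := a₁)).add (hh.const_mul a₂)).add (hh.mul he)
  have hEt : Tendsto (fun h => E (φ h - a₀)) (nhdsWithin 0 (Set.Ioi 0)) (nhds 0) :=
    hE.comp (by simpa using hφt.sub_const a₀)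
  refine ⟨fun h => deriv g a₀ * e h
    + iteratedDeriv 2 g a₀ / 2 * ((a₁ + a₂ * h + h * e h) ^ 2 - a₁ ^ 2)
    + (a₁ + a₂ * h + h * e h) ^ 2 * E (φ h - a₀), ?_, ?_⟩
  · have hsq := (hq.pow 2).sub_const (a₁ ^ 2)
    rw [sub_self] at hsq
    simpa using ((he.const_mul (deriv g a₀)).add
      (hsq.const_mul (iteratedDeriv 2 g a₀ / 2))).add
      ((hq.pow 2).mul hEt)
  · filter_upwards [hφ] with h h1
    have h2 := hEeq (φ h - a₀)
    have h3 : φ h - a₀ = h * (a₁ + a₂ * h + h * e h) := by rw [h1]; ring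
    simp only [Finset.sum_range_succ, Finset.sum_range_zero, iteratedDeriv_zero,
      iteratedDeriv_one] at h2
    rw [add_sub_cancel] at h2
    rw [h2, h3]
    simp [Nat.factorial]
    ring

end HasJetTwo

namespace HasJetThree

variable {φ ψ : ℝ → ℝ} {a₀ a₁ a₂ a₃ b₀ b₁ b₂ b₃ : ℝ}

theorem tendsto (hφ : HasJetThree φ a₀ a₁ a₂ a₃) :
    Tendsto φ (nhdsWithin 0 (Set.Ioi 0)) (nhds a₀) := by
  obtain ⟨e, he, hφ⟩ := hφ
  have hh := tendsto_id_nhdsGT_zero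
  refine Tendsto.congr' (EventuallyEq.symm hφ) ?_
  simpa using (((tendsto_const_nhds (x := a₀)).add (hh.const_mul a₁)).add
    ((hh.pow 2).const_mul a₂)).add ((hh.pow 3).const_mul a₃) |>.add ((hh.pow 3).mul he)

theorem mul (hφ : HasJetThree φ a₀ a₁ a₂ a₃) (hψ : HasJetThree ψ b₀ b₁ b₂ b₃) :
    HasJetThree (fun h => φ h * ψ h) (a₀ * b₀) (a₀ * b₁ + a₁ * b₀)
      (a₀ * b₂ + a₁ * b₁ + a₂ * b₀) (a₀ * b₃ + a₁ * b₂ + a₂ * b₁ + a₃ * b₀) := by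
  have hψt := hψ.tendsto
  obtain ⟨e, he, hφ⟩ := hφ
  obtain ⟨e', he', hψ⟩ := hψ
  have hh := tendsto_id_nhdsGT_zero
  refine ⟨fun h => h * (a₁ * b₃ + a₂ * b₂ + a₃ * b₁ + (a₂ * b₃ + a₃ * b₂) * h + a₃ * b₃ * h ^ 2)
    + (a₀ + a₁ * h + a₂ * h ^ 2 + a₃ * h ^ 3) * e' h + e h * ψ h, ?_, ?_⟩
  · have t1 : Tendsto (fun h : ℝ => h * (a₁ * b₃ + a₂ * b₂ + a₃ * b₁
        + (a₂ * b₃ + a₃ * b₂) * h + a₃ * b₃ * h ^ 2))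
        (nhdsWithin 0 (Set.Ioi 0)) (nhds 0) := by
      simpa using hh.mul (((tendsto_const_nhds (x := a₁ * b₃ + a₂ * b₂ + a₃ * b₁)).add
        (hh.const_mul (a₂ * b₃ + a₃ * b₂))).add ((hh.pow 2).const_mul (a₃ * b₃)))
    have t2 : Tendsto (fun h : ℝ => (a₀ + a₁ * h + a₂ * h ^ 2 + a₃ * h ^ 3) * e' h)
        (nhdsWithin 0 (Set.Ioi 0)) (nhds 0) := by
      simpa using ((((tendsto_const_nhds (x := a₀)).add (hh.const_mul a₁)).add
        ((hh.pow 2).const_mul a₂)).add ((hh.pow 3).const_mul a₃)).mul he'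
    simpa using (t1.add t2).add (he.mul hψt)
  · filter_upwards [hφ, hψ] with h h1 h2
    rw [h1, h2]; ring

/-- Half the sum of two functions, to second order. -/
theorem half_add (hφ : HasJetThree φ a₀ a₁ a₂ a₃) (hψ : HasJetThree ψ a₀ b₁ b₂ b₃) :
    HasJetTwo (fun h => (φ h + ψ h) / 2) a₀ ((a₁ + b₁) / 2) ((a₂ + b₂) / 2) := by
  obtain ⟨e, he, hφ⟩ := hφ
  obtain ⟨e', he', hψ⟩ := hψ
  have hh := tendsto_id_nhdsGT_zero
  refine ⟨fun h => h * ((a₃ + b₃) / 2 + (e h + e' h) / 2), ?_, ?_⟩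
  · simpa using hh.mul (((he.add he').div_const 2).const_add ((a₃ + b₃) / 2))
  · filter_upwards [hφ, hψ] with h h1 h2
    rw [h1, h2]; ring

/-- Half the difference quotient of two functions with the same value at `0`. -/
theorem half_sub_div (hφ : HasJetThree φ a₀ a₁ a₂ a₃) (hψ : HasJetThree ψ a₀ b₁ b₂ b₃) :
    HasJetTwo (fun h => (φ h - ψ h) / 2 / h) ((a₁ - b₁) / 2) ((a₂ - b₂) / 2)
      ((a₃ - b₃) / 2) := by
  obtain ⟨e, he, hφ⟩ := hφ
  obtain ⟨e', he', hψ⟩ := hψ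
  refine ⟨fun h => (e h - e' h) / 2, by simpa using (he.sub he').div_const 2, ?_⟩
  filter_upwards [hφ, hψ, self_mem_nhdsWithin] with h h1 h2 h3
  have h3' : h ≠ 0 := ne_of_gt h3
  rw [h1, h2]
  field_simp
  ring

end HasJetThree

/-- Third-order expansion of `h ↦ g (x₀ + c h)`. -/
theorem hasJetThree_comp_affine {g : ℝ → ℝ} (hg : ContDiff ℝ 3 g) (x₀ c : ℝ) :
    HasJetThree (fun h => g (x₀ + c * h)) (g x₀) (c * deriv g x₀)
      (c ^ 2 * iteratedDeriv 2 g x₀ / 2) (c ^ 3 * iteratedDeriv 3 g x₀ / 6) := by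
  obtain ⟨E, hE, hEeq⟩ := exists_taylor_peano (n := 3) hg x₀
  have hh := tendsto_id_nhdsGT_zero
  refine ⟨fun h => c ^ 3 * E (c * h), ?_, Eventually.of_forall fun h => ?_⟩
  · have : Tendsto (fun h => E (c * h)) (nhdsWithin 0 (Set.Ioi 0)) (nhds 0) :=
      hE.comp (by simpa using hh.const_mul c)
    simpa using this.const_mul (c ^ 3)
  · beta_reduce
    rw [hEeq]
    simp only [Finset.sum_range_succ, Finset.sum_range_zero, iteratedDeriv_zero,
      iteratedDeriv_one]
    simp [Nat.factorial]
    ring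

/-- Iterated partial derivatives in the first variable of a smooth function are jointly smooth. -/
theorem contDiff_iteratedDeriv_fst {G : ℝ × ℝ → ℝ} (hG : ContDiff ℝ (⊤ : ℕ∞) G) (n : ℕ) :
    ContDiff ℝ (⊤ : ℕ∞) fun p : ℝ × ℝ => iteratedDeriv n (fun X => G (X, p.2)) p.1 := by
  induction n with
  | zero => simpa using hG
  | succ n ih =>
    have key : (fun p : ℝ × ℝ => iteratedDeriv (n + 1) (fun X => G (X, p.2)) p.1) =
        fun p => fderiv ℝ
          (fun p : ℝ × ℝ => iteratedDeriv n (fun X => G (X, p.2)) p.1) p (1, 0) := by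
      funext p
      rw [iteratedDeriv_succ]
      have h1 : HasFDerivAt (fun p : ℝ × ℝ => iteratedDeriv n (fun X => G (X, p.2)) p.1)
          (fderiv ℝ (fun p : ℝ × ℝ => iteratedDeriv n (fun X => G (X, p.2)) p.1) p)
          (p.1, p.2) :=
        (ih.differentiable (by simp) p).hasFDerivAt
      have h2 : HasDerivAt (fun X : ℝ => (X, p.2)) ((1 : ℝ), (0 : ℝ)) p.1 :=
        (hasDerivAt_id p.1).prodMk (hasDerivAt_const p.1 p.2)
      exact (h1.comp_hasDerivAt p.1 h2).deriv
    rw [key]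
    exact (ih.fderiv_right (m := (⊤ : ℕ∞)) (by simp)).clm_apply contDiff_const

/-- Even-order derivatives of an odd function vanish at the origin. -/
theorem iteratedDeriv_eq_zero_of_odd {g : ℝ → ℝ} (hodd : ∀ x, g (-x) = -g x) {n : ℕ}
    (hn : Even n) : iteratedDeriv n g 0 = 0 := by
  have h1 := iteratedDeriv_comp_neg n g 0
  have h2 : (fun x => g (-x)) = fun x => -g x := funext hodd
  rw [h2, iteratedDeriv_fun_neg, hn.neg_one_pow] at h1
  simp at h1
  linarith

/-- An odd function vanishing to odd order `m` at the origin, to order `m + 2`. -/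
theorem exists_eq_pow_add_pow_of_odd {g : ℝ → ℝ} (hg : ContDiff ℝ (⊤ : ℕ∞) g)
    (hodd : ∀ x, g (-x) = -g x) {m : ℕ} (hm : Odd m)
    (hlow : ∀ j < m, iteratedDeriv j g 0 = 0) (x : ℝ) :
    ∃ θ, |θ| ≤ |x| ∧ g x = iteratedDeriv m g 0 / (m.factorial : ℝ) * x ^ m
      + x ^ (m + 2) * (iteratedDeriv (m + 2) g θ / ((m + 2).factorial : ℝ)) := by
  have hm0 : m ≠ 0 := by rintro rfl; simp at hm
  have hg0 : g 0 = 0 := by simpa using hlow 0 (Nat.pos_of_ne_zero hm0)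
  rcases eq_or_ne x 0 with rfl | hx
  · exact ⟨0, le_rfl, by simp [hg0, hm0]⟩
  have hsm : ContDiff ℝ ((m + 1 : ℕ) + 1 : WithTop ℕ∞) g :=
    hg.of_le (by exact_mod_cast le_top)
  obtain ⟨θ, hθ, hθeq⟩ := taylor_mean_remainder_lagrange_iteratedDeriv (n := m + 1) hx.symm
    hsm.contDiffOn
  refine ⟨θ, ?_, ?_⟩
  · rw [Set.uIoo, Set.mem_Ioo] at hθ
    rcases le_total 0 x with h | h
    · simp only [h, inf_of_le_left, sup_of_le_right] at hθ
      rw [abs_of_pos hθ.1, abs_of_nonneg h]; exact hθ.2.le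
    · simp only [h, inf_of_le_right, sup_of_le_left] at hθ
      rw [abs_of_neg hθ.2, abs_of_nonpos h]; linarith [hθ.1]
  · have hW : ∀ i, iteratedDerivWithin i g (Set.uIcc 0 x) 0 = iteratedDeriv i g 0 := fun i =>
      iteratedDerivWithin_eq_iteratedDeriv (uniqueDiffOn_uIcc hx.symm)
        ((hg.of_le (by exact_mod_cast le_top)).contDiffAt) Set.left_mem_uIcc
    have hsum : taylorWithinEval g (m + 1) (Set.uIcc 0 x) 0 x =
        iteratedDeriv m g 0 / (m.factorial : ℝ) * x ^ m := by
      rw [taylor_within_apply, Finset.sum_range_succ, Finset.sum_range_succ,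
        Finset.sum_eq_zero, hW, hW, iteratedDeriv_eq_zero_of_odd hodd hm.add_one]
      · simp only [sub_zero, smul_eq_mul, mul_zero, add_zero, zero_add]
        ring
      · intro i hi
        rw [hW, hlow i (Finset.mem_range.mp hi), smul_zero]
    rw [hsum, sub_zero] at hθeq
    rw [← sub_eq_iff_eq_add', hθeq]
    ring

/-- The ratio `η(u)/ν(u)` to third order in the grid spacing. -/
theorem hasJetThree_eta_div_nu {β : ℝ} (hβ0 : 0 < β) (hβ1 : β < 1) (D v : ℝ) (u : Fin 3) :
    HasJetThree (fun h => eta β (v * h / D) u / nu β (v * h / D) u) 1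
      (-((1 - ((u : ℕ) : ℝ)) * (v / D)))
      ((1 - ((u : ℕ) : ℝ)) ^ 2 * (v / D) ^ 2 / 2)
      (-(((1 - ((u : ℕ) : ℝ)) ^ 3 / 6 + (1 - ((u : ℕ) : ℝ)) / 12) * (v / D) ^ 3)) := by
  have hβ1' : 1 - β ≠ 0 := by linarith
  have hh := tendsto_id_nhdsGT_zero
  have hden (c : ℝ) : Tendsto (fun h : ℝ => 1 + c * h) (nhdsWithin 0 (Set.Ioi 0)) (nhds 1) := by
    simpa using (hh.const_mul c).const_add 1
  have hquot (c : ℝ) : Tendsto (fun h : ℝ => 2 * c ^ 4 * h / (1 + c * h))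
      (nhdsWithin 0 (Set.Ioi 0)) (nhds 0) := by
    have := (hh.const_mul (2 * c ^ 4)).div (hden c) one_ne_zero
    rw [mul_zero, zero_div] at this
    exact this
  have hne (c : ℝ) : ∀ᶠ h : ℝ in nhdsWithin 0 (Set.Ioi 0), 1 + c * h ≠ 0 :=
    (hden c).eventually_ne one_ne_zero
  fin_cases u
  · refine ⟨fun h => 2 * (v / D / 2) ^ 4 * h / (1 + v / D / 2 * h), hquot _, ?_⟩
    filter_upwards [hne (v / D / 2)] with h h1
    have e1 : v * h / D / 2 = v / D / 2 * h := by ring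
    simp only [eta, nu, e1]
    generalize v / D = a at *
    have h1' : 2 + a * h ≠ 0 := by
      intro h0; apply h1; linarith
    simp
    rw [mul_div_mul_left _ _ (by positivity), show 1 + a / 2 * h = (2 + a * h) / 2 by ring]
    field_simp
    ring
  · refine ⟨fun h => 0, tendsto_const_nhds, Eventually.of_forall fun h => ?_⟩
    simp [eta, nu, hβ1']
  · refine ⟨fun h => 2 * (-(v / D / 2)) ^ 4 * h / (1 + -(v / D / 2) * h), hquot _, ?_⟩
    filter_upwards [hne (-(v / D / 2))] with h h1
    have e1 : v * h / D / 2 = v / D / 2 * h := by ring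
    simp only [eta, nu, e1]
    generalize v / D = a at *
    have h1' : 2 - a * h ≠ 0 := by
      intro h0; apply h1; linarith
    simp
    rw [mul_div_mul_left _ _ (by positivity), show 1 - a / 2 * h = (2 - a * h) / 2 by ring,
      show 1 + -(a / 2 * h) = (2 - a * h) / 2 by ring]
    field_simp
    ring

/-- Coefficients of `q ^ s · ρ₀(r + n h)` with `q = (1 - a h / 2) / (1 + a h / 2)`, where
`R₀, R₁, R₂, R₃` are the derivatives of `ρ₀` at `r`. -/
def zOne (a R₀ R₁ s n : ℝ) : ℝ := n * R₁ - s * a * R₀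

/-- See `zOne`. -/
def zTwo (a R₀ R₁ R₂ s n : ℝ) : ℝ :=
  n ^ 2 * R₂ / 2 - s * a * (n * R₁) + s ^ 2 * a ^ 2 / 2 * R₀

/-- See `zOne`. -/
def zThree (a R₀ R₁ R₂ R₃ s n : ℝ) : ℝ :=
  n ^ 3 * R₃ / 6 - s * a * (n ^ 2 * R₂ / 2) + s ^ 2 * a ^ 2 / 2 * (n * R₁)
    - (s ^ 3 / 6 + s / 12) * a ^ 3 * R₀

theorem hasJetThree_prod_eta_div_nu {β : ℝ} (hβ0 : 0 < β) (hβ1 : β < 1) (D v : ℝ) {K : ℕ}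
    (u : Fin K → Fin 3) :
    HasJetThree (fun h => ∏ d, eta β (v * h / D) (u d) / nu β (v * h / D) (u d)) 1
      (-((∑ d, (1 - ((u d : ℕ) : ℝ))) * (v / D)))
      ((∑ d, (1 - ((u d : ℕ) : ℝ))) ^ 2 * (v / D) ^ 2 / 2)
      (-(((∑ d, (1 - ((u d : ℕ) : ℝ))) ^ 3 / 6 + (∑ d, (1 - ((u d : ℕ) : ℝ))) / 12)
        * (v / D) ^ 3)) := by
  classical
  induction (Finset.univ : Finset (Fin K)) using Finset.induction_on with
  | empty => exact ⟨fun _ => 0, tendsto_const_nhds, Eventually.of_forall fun h => by simp⟩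
  | insert d S hd ih =>
    simp only [Finset.prod_insert hd, Finset.sum_insert hd]
    convert (hasJetThree_eta_div_nu hβ0 hβ1 D v (u d)).mul ih using 1 <;> ring

/-- Third-order expansion of the weighted local density. -/
theorem hasJetThree_mul_rhoHat {β : ℝ} (hβ0 : 0 < β) (hβ1 : β < 1) (D v r : ℝ) {ρ₀ : ℝ → ℝ}
    (hρ : ContDiff ℝ (⊤ : ℕ∞) ρ₀) {K : ℕ} (j : ℤ) (c : Fin 3) (u : Fin K → Fin 3)
    {s n : ℝ} (hs : s = (1 - ((c : ℕ) : ℝ)) + ∑ d, (1 - ((u d : ℕ) : ℝ)))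
    (hn : n = (j : ℝ) + ∑ d, (1 - ((u d : ℕ) : ℝ))) :
    HasJetThree (fun h => eta β (v * h / D) c / nu β (v * h / D) c *
        rhoHat β (v * h / D) r h ρ₀ j u) (ρ₀ r)
      (zOne (v / D) (ρ₀ r) (deriv ρ₀ r) s n)
      (zTwo (v / D) (ρ₀ r) (deriv ρ₀ r) (iteratedDeriv 2 ρ₀ r) s n)
      (zThree (v / D) (ρ₀ r) (deriv ρ₀ r) (iteratedDeriv 2 ρ₀ r) (iteratedDeriv 3 ρ₀ r) s n) := by
  have h3 : ContDiff ℝ 3 ρ₀ := by exact_mod_cast contDiff_infty.mp hρ 3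
  subst hn hs
  convert (hasJetThree_eta_div_nu hβ0 hβ1 D v c).mul
    ((hasJetThree_prod_eta_div_nu hβ0 hβ1 D v u).mul
      (hasJetThree_comp_affine h3 r ((j : ℝ) + ∑ d, (1 - ((u d : ℕ) : ℝ))))) using 1
  · rfl
  · ring
  · simp only [zOne]; ring
  · simp only [zTwo]; ring
  · simp only [zThree]; ring

theorem HasJetTwo.pow_add_two {φ : ℝ → ℝ} {a₀ a₁ a₂ : ℝ} (hφ : HasJetTwo φ a₀ a₁ a₂) (n : ℕ) :
    HasJetTwo (fun h => φ h ^ (n + 2)) (a₀ ^ (n + 2)) (((n : ℝ) + 2) * (a₀ * a₀ ^ n) * a₁)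
      (((n : ℝ) + 2) * (a₀ * a₀ ^ n) * a₂
        + ((n : ℝ) + 2) * ((n : ℝ) + 1) / 2 * a₀ ^ n * a₁ ^ 2) := by
  induction n with
  | zero =>
    convert hφ.mul hφ using 1
    · funext h; ring
    · ring
    · push_cast; ring
    · push_cast; ring
  | succ n ih =>
    convert ih.mul hφ using 1
    · funext h; ring
    · ring
    · push_cast; ring
    · push_cast; ring

/-- First-order coefficient of `Ĉ(Y(h)) X(h)ᵐ`, where `P` stands for `X₀ ^ (m - 2)` and
`μ` for `m`. -/
def coefOne (C₀ C₁ μ P X₀ X₁ Y₁ : ℝ) : ℝ :=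
  C₀ * (μ * (X₀ * P) * X₁) + C₁ * Y₁ * (X₀ ^ 2 * P)

/-- Second-order coefficient of `Ĉ(Y(h)) X(h)ᵐ + h² B X(h)ᵐ⁺²`, with the conventions of
`coefOne`. -/
def coefTwo (C₀ C₁ C₂ B μ P X₀ X₁ X₂ Y₁ Y₂ : ℝ) : ℝ :=
  C₀ * (μ * (X₀ * P) * X₂ + μ * (μ - 1) / 2 * P * X₁ ^ 2)
    + C₁ * Y₁ * (μ * (X₀ * P) * X₁)
    + (C₁ * Y₂ + C₂ / 2 * Y₁ ^ 2) * (X₀ ^ 2 * P) + B * (X₀ ^ 4 * P)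

/-- Second-order expansion of `f (x h) (y h) / hᵐ` when `x` and `y` agree at `0`. -/
theorem hasJetTwo_apply_div_pow {f : ℝ → ℝ → ℝ} {Chat : ℝ → ℝ} {n : ℕ}
    (hf : ContDiff ℝ (⊤ : ℕ∞) (Function.uncurry f)) (hn : Odd n)
    (hsym : ∀ x y, f y x = -f x y)
    (hlow : ∀ Y : ℝ, ∀ j < n + 2, iteratedDeriv j (fun X => ftilde f X Y) 0 = 0)
    (hchar : ∀ Y : ℝ, iteratedDeriv (n + 2) (fun X => ftilde f X Y) 0 =
      ((n + 2).factorial : ℝ) * Chat Y)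
    {x y : ℝ → ℝ} {R x₁ x₂ x₃ y₁ y₂ y₃ : ℝ}
    (hx : HasJetThree x R x₁ x₂ x₃) (hy : HasJetThree y R y₁ y₂ y₃) :
    HasJetTwo (fun h => f (x h) (y h) / h ^ (n + 2)) (Chat R * ((x₁ - y₁) / 2) ^ (n + 2))
      (coefOne (Chat R) (deriv Chat R) ((n : ℝ) + 2) (((x₁ - y₁) / 2) ^ n) ((x₁ - y₁) / 2)
        ((x₂ - y₂) / 2) ((x₁ + y₁) / 2))
      (coefTwo (Chat R) (deriv Chat R) (iteratedDeriv 2 Chat R)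
        (iteratedDeriv (n + 2 + 2) (fun X => ftilde f X R) 0 / ((n + 2 + 2).factorial : ℝ))
        ((n : ℝ) + 2) (((x₁ - y₁) / 2) ^ n) ((x₁ - y₁) / 2)
        ((x₂ - y₂) / 2) ((x₃ - y₃) / 2) ((x₁ + y₁) / 2) ((x₂ + y₂) / 2)) := by
  have hG : ContDiff ℝ (⊤ : ℕ∞) fun p : ℝ × ℝ => ftilde f p.1 p.2 := by
    have : (fun p : ℝ × ℝ => ftilde f p.1 p.2) =
        fun p : ℝ × ℝ => Function.uncurry f (p.2 + p.1, p.2 - p.1) := rfl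
    rw [this]
    exact hf.comp ((contDiff_snd.add contDiff_fst).prodMk (contDiff_snd.sub contDiff_fst))
  have hfac : ((n + 2).factorial : ℝ) ≠ 0 := by positivity
  have hChat : ContDiff ℝ 2 Chat := by
    have h1 : Chat = fun Y => (fun p : ℝ × ℝ =>
        iteratedDeriv (n + 2) (fun X => ftilde f X p.2) p.1) (0, Y)
          / ((n + 2).factorial : ℝ) := by
      funext Y
      simp only
      rw [hchar Y, mul_div_cancel_left₀ _ hfac]
    rw [h1]
    have h2 := ((contDiff_iteratedDeriv_fst hG (n + 2)).comp
      (contDiff_prodMk_right (0 : ℝ))).div_const ((n + 2).factorial : ℝ)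
    exact_mod_cast contDiff_infty.mp h2 2
  have hX := hx.half_sub_div hy
  have hY := hx.half_add hy
  have hh := tendsto_id_nhdsGT_zero
  have hexp (h : ℝ) := exists_eq_pow_add_pow_of_odd (g := fun X => ftilde f X ((x h + y h) / 2))
    (hG.comp (contDiff_id.prodMk contDiff_const)) (fun X => by
      simp only [ftilde, ← sub_eq_add_neg, sub_neg_eq_add]; exact hsym _ _)
    (m := n + 2) (hn.add_even even_two) (hlow _) ((x h - y h) / 2)
  choose θ hθ hfeq using hexp
  have hdiff : Tendsto (fun h => (x h - y h) / 2) (nhdsWithin 0 (Set.Ioi 0)) (nhds 0) := by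
    simpa using (hx.tendsto.sub hy.tendsto).div_const 2
  have hθt : Tendsto θ (nhdsWithin 0 (Set.Ioi 0)) (nhds 0) :=
    squeeze_zero_norm (fun h => hθ h) (by simpa using hdiff.abs)
  have hb : Tendsto (fun h => iteratedDeriv (n + 2 + 2)
        (fun X => ftilde f X ((x h + y h) / 2)) (θ h) / ((n + 2 + 2).factorial : ℝ))
      (nhdsWithin 0 (Set.Ioi 0))
      (nhds (iteratedDeriv (n + 2 + 2) (fun X => ftilde f X R) 0
        / ((n + 2 + 2).factorial : ℝ))) :=
    (((contDiff_iteratedDeriv_fst hG (n + 2 + 2)).continuous.tendsto (0, R)).comp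
      (hθt.prodMk_nhds hY.tendsto)).div_const _
  set b := fun h => iteratedDeriv (n + 2 + 2)
        (fun X => ftilde f X ((x h + y h) / 2)) (θ h) / ((n + 2 + 2).factorial : ℝ)
  set B := iteratedDeriv (n + 2 + 2) (fun X => ftilde f X R) 0 / ((n + 2 + 2).factorial : ℝ)
  have hrem : HasJetTwo (fun h => h ^ 2 * (((x h - y h) / 2 / h) ^ (n + 2 + 2) * b h)) 0 0
      (((x₁ - y₁) / 2) ^ (n + 2 + 2) * B) := by
    refine ⟨fun h => ((x h - y h) / 2 / h) ^ (n + 2 + 2) * b h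
      - ((x₁ - y₁) / 2) ^ (n + 2 + 2) * B, ?_, Eventually.of_forall fun h => by ring⟩
    simpa using ((hX.tendsto.pow (n + 2 + 2)).mul hb).sub_const
      (((x₁ - y₁) / 2) ^ (n + 2 + 2) * B)
  have hsum := ((hY.comp hChat).mul (hX.pow_add_two n)).add hrem
  have hjet : HasJetTwo (fun h => f (x h) (y h) / h ^ (n + 2)) _ _ _ := hsum.congr' (by
    filter_upwards [self_mem_nhdsWithin] with h hpos
    have h0 : h ≠ 0 := ne_of_gt hpos
    have e1 : f (x h) (y h) = ftilde f ((x h - y h) / 2) ((x h + y h) / 2) := by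
      simp only [ftilde]; congr 1 <;> ring
    rw [e1, hfeq h, hchar, mul_div_cancel_left₀ _ hfac]
    change (_ + _ * b h) / _ = _
    rw [add_div]
    congr 1
    · rw [div_pow _ h]; ring
    · rw [div_pow _ h, pow_add h (n + 2) 2]
      field_simp)
  convert hjet using 1
  · ring
  · simp only [coefOne]; ring
  · simp only [coefTwo]; ring

theorem sum_range_two_mul_eq (g : ℕ → ℝ) (K : ℕ) :
    ∑ i ∈ Finset.range (2 * K), g i =
      ∑ p ∈ Finset.range K, g (2 * p) + ∑ p ∈ Finset.range K, g (2 * p + 1) := by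
  induction K with
  | zero => simp
  | succ K ih =>
    rw [show 2 * (K + 1) = 2 * K + 1 + 1 by ring, Finset.sum_range_succ, Finset.sum_range_succ,
      ih, Finset.sum_range_succ, Finset.sum_range_succ]
    ring

/-- Binomial sums over the even and the odd powers of `A` for an odd exponent. -/
theorem sum_choose_odd_exponent (A B : ℝ) (M : ℕ) :
    (∑ p ∈ Finset.range (M + 1),
      ((2 * M + 1).choose (2 * p) : ℝ) * A ^ (2 * p) * B ^ (2 * (M - p) + 1) =
        ((A + B) ^ (2 * M + 1) - (A - B) ^ (2 * M + 1)) / 2) ∧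
    (∑ p ∈ Finset.range (M + 1),
      ((2 * M + 1).choose (2 * p + 1) : ℝ) * A ^ (2 * p + 1) * B ^ (2 * (M - p)) =
        ((A + B) ^ (2 * M + 1) + (A - B) ^ (2 * M + 1)) / 2) := by
  have key (b : ℝ) : (A + b) ^ (2 * M + 1) =
      ∑ p ∈ Finset.range (M + 1),
        ((2 * M + 1).choose (2 * p) : ℝ) * A ^ (2 * p) * b ^ (2 * (M - p) + 1) +
      ∑ p ∈ Finset.range (M + 1),
        ((2 * M + 1).choose (2 * p + 1) : ℝ) * A ^ (2 * p + 1) * b ^ (2 * (M - p)) := by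
    rw [add_pow, show 2 * M + 1 + 1 = 2 * (M + 1) by ring, sum_range_two_mul_eq]
    congr 1 <;> refine Finset.sum_congr rfl fun p hp => ?_ <;>
      have hp' := Finset.mem_range.mp hp
    · rw [show 2 * M + 1 - 2 * p = 2 * (M - p) + 1 by omega]; ring
    · rw [show 2 * M + 1 - (2 * p + 1) = 2 * (M - p) by omega]; ring
  have h2 := key (-B)
  have e1 (p : ℕ) : (-B) ^ (2 * (M - p) + 1) = -B ^ (2 * (M - p) + 1) :=
    Odd.neg_pow (odd_two_mul_add_one _) _
  have e2 (p : ℕ) : (-B) ^ (2 * (M - p)) = B ^ (2 * (M - p)) :=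
    Even.neg_pow (even_two_mul _) _
  simp only [e1, e2, mul_neg, Finset.sum_neg_distrib, ← sub_eq_add_neg] at h2
  rw [key B, h2]
  constructor <;> ring

/-- Binomial sums over the even and the odd powers of `A` for an even exponent. -/
theorem sum_choose_even_exponent (A B : ℝ) (M : ℕ) :
    (∑ p ∈ Finset.range (M + 1),
      ((2 * M).choose (2 * p) : ℝ) * A ^ (2 * p) * B ^ (2 * (M - p)) =
        ((A + B) ^ (2 * M) + (A - B) ^ (2 * M)) / 2) ∧
    (∑ p ∈ Finset.range M,
      ((2 * M).choose (2 * p + 1) : ℝ) * A ^ (2 * p + 1) * B ^ (2 * (M - p) - 1) =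
        ((A + B) ^ (2 * M) - (A - B) ^ (2 * M)) / 2) := by
  have key (b : ℝ) : (A + b) ^ (2 * M) =
      ∑ p ∈ Finset.range (M + 1),
        ((2 * M).choose (2 * p) : ℝ) * A ^ (2 * p) * b ^ (2 * (M - p)) +
      ∑ p ∈ Finset.range M,
        ((2 * M).choose (2 * p + 1) : ℝ) * A ^ (2 * p + 1) * b ^ (2 * (M - p) - 1) := by
    rw [add_pow, Finset.sum_range_succ, sum_range_two_mul_eq, Finset.sum_range_succ,
      add_right_comm]
    congr 1
    · congr 1
      · refine Finset.sum_congr rfl fun p hp => ?_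
        rw [show 2 * M - 2 * p = 2 * (M - p) by omega]; ring
      · simp
    · refine Finset.sum_congr rfl fun p hp => ?_
      rw [show 2 * M - (2 * p + 1) = 2 * (M - p) - 1 by omega]; ring
  have h2 := key (-B)
  have e2 (p : ℕ) : (-B) ^ (2 * (M - p)) = B ^ (2 * (M - p)) :=
    Even.neg_pow (even_two_mul _) _
  have e3 : ∑ p ∈ Finset.range M, ((2 * M).choose (2 * p + 1) : ℝ) * A ^ (2 * p + 1) *
        (-B) ^ (2 * (M - p) - 1) =
      -∑ p ∈ Finset.range M, ((2 * M).choose (2 * p + 1) : ℝ) * A ^ (2 * p + 1) *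
        B ^ (2 * (M - p) - 1) := by
    rw [← Finset.sum_neg_distrib]
    refine Finset.sum_congr rfl fun p hp => ?_
    have hp' := Finset.mem_range.mp hp
    rw [show 2 * (M - p) - 1 = 2 * (M - p - 1) + 1 by omega,
      Odd.neg_pow (odd_two_mul_add_one _)]
    ring
  simp only [e2, e3, ← sub_eq_add_neg] at h2
  rw [key B, h2]
  constructor <;> ring

/-- Separating off the top term, the only one in which the exponent `2 (M - p)` is zero. -/
theorem sum_mul_ite_exponent (c : ℕ → ℝ) (g : ℝ → ℝ) (β : ℝ) (M : ℕ) :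
    ∑ p ∈ Finset.range (M + 1), c p * g (if 2 * (M - p) = 0 then 1 else β) =
      (∑ p ∈ Finset.range (M + 1), c p) * g β + c M * (g 1 - g β) := by
  rw [Finset.sum_range_succ, Finset.sum_range_succ, add_mul, Finset.sum_mul]
  have : ∀ p ∈ Finset.range M, c p * g (if 2 * (M - p) = 0 then 1 else β) = c p * g β := by
    intro p hp
    have hp' := Finset.mem_range.mp hp
    rw [if_neg (by omega)]
  rw [Finset.sum_congr rfl this]
  simp
  ring

/-- Leading coefficient of the half difference for outer digit `1 - c` and inner digit `1 - t`. -/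
def xZero (a R₀ R₁ c t : ℝ) : ℝ := (-(t * R₁) - (c - t) * a * R₀) / 2

/-- First-order coefficient of `F_j` divided by `hᵐ`, for outer digit `1 - c`, inner digit
`1 - t` and total displacement `w`; `P` stands for `xZero a R₀ R₁ c t ^ (m - 2)`. -/
def jetOne (a R₀ R₁ R₂ C₀ C₁ μ P c j t w : ℝ) : ℝ :=
  coefOne C₀ C₁ μ P (xZero a R₀ R₁ c t)
    ((zTwo a R₀ R₁ R₂ (c + w) (j + w) - zTwo a R₀ R₁ R₂ (t + w) (j + t + w)) / 2)
    ((zOne a R₀ R₁ (c + w) (j + w) + zOne a R₀ R₁ (t + w) (j + t + w)) / 2)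

/-- Second-order coefficient of `F_j` divided by `hᵐ`, with the conventions of `jetOne`. -/
def jetTwo (a R₀ R₁ R₂ R₃ C₀ C₁ C₂ B μ P c j t w : ℝ) : ℝ :=
  coefTwo C₀ C₁ C₂ B μ P (xZero a R₀ R₁ c t)
    ((zTwo a R₀ R₁ R₂ (c + w) (j + w) - zTwo a R₀ R₁ R₂ (t + w) (j + t + w)) / 2)
    ((zThree a R₀ R₁ R₂ R₃ (c + w) (j + w) - zThree a R₀ R₁ R₂ R₃ (t + w) (j + t + w)) / 2)
    ((zOne a R₀ R₁ (c + w) (j + w) + zOne a R₀ R₁ (t + w) (j + t + w)) / 2)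
    ((zTwo a R₀ R₁ R₂ (c + w) (j + w) + zTwo a R₀ R₁ R₂ (t + w) (j + t + w)) / 2)

/-- First-order coefficient of `F₀(2,u) - F₋₁(2,u) - F₀(0,u) + F₁(0,u)` divided by `hᵐ`. -/
def bracketOne (a R₀ R₁ R₂ C₀ C₁ μ P Q t w : ℝ) : ℝ :=
  jetOne a R₀ R₁ R₂ C₀ C₁ μ P (-1) 0 t w - jetOne a R₀ R₁ R₂ C₀ C₁ μ P (-1) (-1) t w
    - jetOne a R₀ R₁ R₂ C₀ C₁ μ Q 1 0 t w + jetOne a R₀ R₁ R₂ C₀ C₁ μ Q 1 1 t w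

/-- Second-order coefficient of `F₀(2,u) - F₋₁(2,u) - F₀(0,u) + F₁(0,u)` divided by `hᵐ`. -/
def bracketTwo (a R₀ R₁ R₂ R₃ C₀ C₁ C₂ B μ P Q t w : ℝ) : ℝ :=
  jetTwo a R₀ R₁ R₂ R₃ C₀ C₁ C₂ B μ P (-1) 0 t w
    - jetTwo a R₀ R₁ R₂ R₃ C₀ C₁ C₂ B μ P (-1) (-1) t w
    - jetTwo a R₀ R₁ R₂ R₃ C₀ C₁ C₂ B μ Q 1 0 t w + jetTwo a R₀ R₁ R₂ R₃ C₀ C₁ C₂ B μ Q 1 1 t w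

theorem bracketOne_displacement (a R₀ R₁ R₂ C₀ C₁ μ P Q t w : ℝ) :
    bracketOne a R₀ R₁ R₂ C₀ C₁ μ P Q t w = bracketOne a R₀ R₁ R₂ C₀ C₁ μ P Q t 0 := by
  simp only [bracketOne, jetOne, coefOne, zOne, zTwo]
  ring

theorem bracketTwo_displacement (a R₀ R₁ R₂ R₃ C₀ C₁ C₂ B μ P Q t w : ℝ) :
    bracketTwo a R₀ R₁ R₂ R₃ C₀ C₁ C₂ B μ P Q t w =
      bracketTwo a R₀ R₁ R₂ R₃ C₀ C₁ C₂ B μ P Q t 0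
        + w * (bracketTwo a R₀ R₁ R₂ R₃ C₀ C₁ C₂ B μ P Q t 1
          - bracketTwo a R₀ R₁ R₂ R₃ C₀ C₁ C₂ B μ P Q t 0) := by
  simp only [bracketTwo, jetTwo, coefTwo, zOne, zTwo, zThree]
  ring

theorem bracketOne_middle (a R₀ R₁ R₂ C₀ C₁ μ P : ℝ) :
    bracketOne a R₀ R₁ R₂ C₀ C₁ μ P (-P) 0 0 = 0 := by
  simp only [bracketOne, jetOne, coefOne, zOne, zTwo, xZero]
  ring

theorem bracketOne_reflect (a R₀ R₁ R₂ C₀ C₁ μ P Q : ℝ) :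
    bracketOne a R₀ R₁ R₂ C₀ C₁ μ P (-Q) 1 0 + bracketOne a R₀ R₁ R₂ C₀ C₁ μ Q (-P) (-1) 0
      = 0 := by
  simp only [bracketOne, jetOne, coefOne, zOne, zTwo, xZero]
  ring

/-- The closed form of `LII2` in terms of the second-order coefficients. -/
theorem LII2_eq_bracket (D v β r : ℝ) (ρ₀ Chat : ℝ → ℝ) (M : ℕ) (B : ℝ) {P Q S : ℝ}
    (hP : P = xZero (v / D) (ρ₀ r) (deriv ρ₀ r) (-1) 1 ^ (2 * M + 1))
    (hQ : Q = xZero (v / D) (ρ₀ r) (deriv ρ₀ r) (-1) (-1) ^ (2 * M + 1))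
    (hS : S = xZero (v / D) (ρ₀ r) (deriv ρ₀ r) (-1) 0 ^ (2 * M + 1)) :
    LII2 D v β r ρ₀ Chat (2 * (M + 1) + 1) (M + 1) =
      v * (β * (v / D) / 2 * bracketOne (v / D) (ρ₀ r) (deriv ρ₀ r) (iteratedDeriv 2 ρ₀ r)
          (Chat (ρ₀ r)) (deriv Chat (ρ₀ r)) (2 * M + 1 + 2) P (-Q) 1 0
        + β / 2 * (bracketTwo (v / D) (ρ₀ r) (deriv ρ₀ r) (iteratedDeriv 2 ρ₀ r)
            (iteratedDeriv 3 ρ₀ r) (Chat (ρ₀ r)) (deriv Chat (ρ₀ r))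
            (iteratedDeriv 2 Chat (ρ₀ r)) B (2 * M + 1 + 2) P (-Q) 1 0
          + bracketTwo (v / D) (ρ₀ r) (deriv ρ₀ r) (iteratedDeriv 2 ρ₀ r)
            (iteratedDeriv 3 ρ₀ r) (Chat (ρ₀ r)) (deriv Chat (ρ₀ r))
            (iteratedDeriv 2 Chat (ρ₀ r)) B (2 * M + 1 + 2) Q (-P) (-1) 0)
        + (1 - β) * bracketTwo (v / D) (ρ₀ r) (deriv ρ₀ r) (iteratedDeriv 2 ρ₀ r)
            (iteratedDeriv 3 ρ₀ r) (Chat (ρ₀ r)) (deriv Chat (ρ₀ r))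
            (iteratedDeriv 2 Chat (ρ₀ r)) B (2 * M + 1 + 2) S (-S) 0 0) := by
  unfold LII2
  extract_lets -merge ρ ρr ρrr ρrrr X10 X01 Y110 Y210 Y101 Y201 X120 X220 X111 X211 X102 X202 Y120 Y220
    Y111 Y211 Y102 Y202 X130 X230 X121 X221 X112 X212 X103 X203 Snu Cd Cdd
  rw [show 2 * (M + 1) + 1 - 1 = 2 * (M + 1) by omega,
    show 2 * (M + 1) + 1 - 2 = 2 * M + 1 by omega]
  have hshift (p : ℕ) : M + 1 - p - 1 = M - p := by omega
  simp only [hshift]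
  obtain ⟨hm0, hm1⟩ := sum_choose_odd_exponent X10 X01 (M + 1)
  obtain ⟨hm2, hm3⟩ := sum_choose_even_exponent X10 X01 (M + 1)
  obtain ⟨hm4, hm5⟩ := sum_choose_odd_exponent X10 X01 M
  have hm4' : ∑ p ∈ Finset.range (M + 1),
      ((2 * M + 1).choose (2 * p) : ℝ) * X10 ^ (2 * p) * X01 ^ (2 * (M + 1 - p) - 1) =
        ((X10 + X01) ^ (2 * M + 1) - (X10 - X01) ^ (2 * M + 1)) / 2 := by
    rw [← hm4]
    refine Finset.sum_congr rfl fun p hp => ?_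
    have hp' := Finset.mem_range.mp hp
    rw [show 2 * (M + 1 - p) - 1 = 2 * (M - p) + 1 by omega]
  have hs1 := sum_mul_ite_exponent
    (fun p => ((2 * (M + 1) + 1).choose (2 * p + 1) : ℝ) * X10 ^ (2 * p + 1)
      * X01 ^ (2 * (M + 1 - p)))
    (fun S => Cd * (β * Y102 + Y120 * S - β * Y202 - Y220 * S) +
      1 / 2 * Cdd * (β * Y101 ^ 2 + Y110 ^ 2 * S - β * Y201 ^ 2 - Y210 ^ 2 * S)) β (M + 1)
  have hs2 := sum_mul_ite_exponent
    (fun p => ((2 * (M + 1)).choose (2 * p) : ℝ) * X10 ^ (2 * p) * X01 ^ (2 * (M + 1 - p)))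
    (fun S => Cd * (β * X102 * Y110 + β * X111 * Y101 + X120 * Y110 * S -
        (β * X202 * Y210 + β * X211 * Y201 + X220 * Y210 * S)) +
      Chat ρ * (β * X112 + X130 * S - (β * X212 + X230 * S))) β (M + 1)
  have hs3 := sum_mul_ite_exponent
    (fun p => ((2 * M + 1).choose (2 * p + 1) : ℝ) * X10 ^ (2 * p + 1) * X01 ^ (2 * (M - p)))
    (fun S => β * X102 ^ 2 + 2 * β * X102 * X120 + β * X111 ^ 2 + X120 ^ 2 * S -
        (β * X202 ^ 2 + 2 * β * X202 * X220 + β * X211 ^ 2 + X220 ^ 2 * S)) β M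
  beta_reduce at hs1 hs2 hs3
  simp only [Snu]
  rw [hs1, hs2, hs3]
  simp only [← Finset.sum_mul]
  rw [hm0, hm1, hm2, hm3, hm4', hm5]
  simp only [Nat.choose_self, Nat.sub_self, mul_zero, pow_zero, mul_one, Nat.cast_one, one_mul]
  have hP' : P = (X10 - X01) ^ (2 * M + 1) / 2 ^ (2 * M + 1) := by
    rw [hP, ← div_pow]; congr 1; simp only [xZero, X10, X01, ρ, ρr]; ring
  have hQ' : Q = (X10 + X01) ^ (2 * M + 1) / 2 ^ (2 * M + 1) := by
    rw [hQ, ← div_pow]; congr 1; simp only [xZero, X10, X01, ρ, ρr]; ring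
  have hS' : S = X10 ^ (2 * M + 1) / 2 ^ (2 * M + 1) := by
    rw [hS, ← div_pow]; congr 1; simp only [xZero, X10]; ring
  have hpow1 (z : ℝ) : z ^ (2 * (M + 1) + 1) = z ^ 2 * z ^ (2 * M + 1) := by ring
  have hpow2 (z : ℝ) : z ^ (2 * (M + 1)) = z * z ^ (2 * M + 1) := by ring
  have hpow3 : (2 : ℝ) ^ (2 * (M + 1) + 1 + 1) = 8 * 2 ^ (2 * M + 1) := by ring
  have hpow4 : (2 : ℝ) ^ (2 * (M + 1) + 1 + 2) = 16 * 2 ^ (2 * M + 1) := by ring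
  rw [hpow3, hpow4, hP', hQ', hS']
  simp only [hpow1, hpow2]
  generalize (X10 - X01) ^ (2 * M + 1) = G
  generalize (X10 + X01) ^ (2 * M + 1) = E
  generalize X10 ^ (2 * M + 1) = H
  generalize (2 : ℝ) ^ (2 * M + 1) = T
  simp only [bracketOne, bracketTwo, jetOne, jetTwo, coefOne, coefTwo, zOne, zTwo, zThree, xZero,
    ρ, ρr, ρrr, ρrrr, X10, X01, Y110, Y210, Y101, Y201, X120, X220, X111, X211, X102, X202,
    Y120, Y220, Y111, Y211, Y102, Y202, X130, X230, X121, X221, X112, X212, X103, X203, Cd, Cdd]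
  clear * -
  generalize ρ₀ r = R₀
  generalize deriv ρ₀ r = R₁
  generalize iteratedDeriv 2 ρ₀ r = R₂
  generalize iteratedDeriv 3 ρ₀ r = R₃
  generalize iteratedDeriv 2 Chat R₀ = C₂
  generalize deriv Chat R₀ = C₁
  generalize Chat R₀ = C₀
  push_cast
  ring

theorem hasJetTwo_Floc {D v β r : ℝ} {ρ₀ Chat : ℝ → ℝ} {f : ℝ → ℝ → ℝ} {n : ℕ}
    (hβ0 : 0 < β) (hβ1 : β < 1) (hρ : ContDiff ℝ (⊤ : ℕ∞) ρ₀)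
    (hf : ContDiff ℝ (⊤ : ℕ∞) (Function.uncurry f)) (hn : Odd n)
    (hsym : ∀ x y, f y x = -f x y)
    (hlow : ∀ Y : ℝ, ∀ j < n + 2, iteratedDeriv j (fun X => ftilde f X Y) 0 = 0)
    (hchar : ∀ Y : ℝ, iteratedDeriv (n + 2) (fun X => ftilde f X Y) 0 =
      ((n + 2).factorial : ℝ) * Chat Y)
    {K : ℕ} (j : ℤ) (ω u₀ : Fin 3) (u' : Fin K → Fin 3) :
    HasJetTwo (fun h => Floc β (v * h / D) r h ρ₀ f j ω u₀ u' / h ^ (n + 2))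
      (Chat (ρ₀ r) * xZero (v / D) (ρ₀ r) (deriv ρ₀ r) (1 - ((ω : ℕ) : ℝ))
        (1 - ((u₀ : ℕ) : ℝ)) ^ (n + 2))
      (jetOne (v / D) (ρ₀ r) (deriv ρ₀ r) (iteratedDeriv 2 ρ₀ r) (Chat (ρ₀ r))
        (deriv Chat (ρ₀ r)) ((n : ℝ) + 2)
        (xZero (v / D) (ρ₀ r) (deriv ρ₀ r) (1 - ((ω : ℕ) : ℝ)) (1 - ((u₀ : ℕ) : ℝ)) ^ n)
        (1 - ((ω : ℕ) : ℝ)) j (1 - ((u₀ : ℕ) : ℝ)) (∑ d, (1 - ((u' d : ℕ) : ℝ))))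
      (jetTwo (v / D) (ρ₀ r) (deriv ρ₀ r) (iteratedDeriv 2 ρ₀ r) (iteratedDeriv 3 ρ₀ r)
        (Chat (ρ₀ r)) (deriv Chat (ρ₀ r)) (iteratedDeriv 2 Chat (ρ₀ r))
        (iteratedDeriv (n + 2 + 2) (fun X => ftilde f X (ρ₀ r)) 0
          / ((n + 2 + 2).factorial : ℝ)) ((n : ℝ) + 2)
        (xZero (v / D) (ρ₀ r) (deriv ρ₀ r) (1 - ((ω : ℕ) : ℝ)) (1 - ((u₀ : ℕ) : ℝ)) ^ n)
        (1 - ((ω : ℕ) : ℝ)) j (1 - ((u₀ : ℕ) : ℝ)) (∑ d, (1 - ((u' d : ℕ) : ℝ)))) := by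
  have hx := hasJetThree_mul_rhoHat hβ0 hβ1 D v r hρ j ω u' rfl rfl
  have hy := hasJetThree_mul_rhoHat hβ0 hβ1 D v r hρ (j + 1 - ((u₀ : ℕ) : ℤ)) u₀ u'
    (n := (j : ℝ) + (1 - ((u₀ : ℕ) : ℝ)) + ∑ d, (1 - ((u' d : ℕ) : ℝ))) rfl
    (by push_cast; ring)
  have h := hasJetTwo_apply_div_pow hf hn hsym hlow hchar hx hy
  have e : xZero (v / D) (ρ₀ r) (deriv ρ₀ r) (1 - ((ω : ℕ) : ℝ)) (1 - ((u₀ : ℕ) : ℝ)) =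
      (zOne (v / D) (ρ₀ r) (deriv ρ₀ r)
          (1 - ((ω : ℕ) : ℝ) + ∑ d, (1 - ((u' d : ℕ) : ℝ)))
          (j + ∑ d, (1 - ((u' d : ℕ) : ℝ)))
        - zOne (v / D) (ρ₀ r) (deriv ρ₀ r)
          (1 - ((u₀ : ℕ) : ℝ) + ∑ d, (1 - ((u' d : ℕ) : ℝ)))
          (j + (1 - ((u₀ : ℕ) : ℝ)) + ∑ d, (1 - ((u' d : ℕ) : ℝ)))) / 2 := by
    simp only [xZero, zOne]; ring
  simp only [jetOne, jetTwo, e]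
  exact h

theorem sum_prod_nu (β Pe : ℝ) (K : ℕ) :
    ∑ u : Fin K → Fin 3, ∏ d, nu β Pe (u d) = 1 := by
  have h1 : ∑ x : Fin 3, nu β Pe x = 1 := by
    simp [Fin.sum_univ_three, nu]; ring
  have h2 := Finset.prod_univ_sum (fun _ : Fin K => (Finset.univ : Finset (Fin 3)))
    (fun _ x => nu β Pe x)
  simp only [h1, Finset.prod_const_one, Fintype.piFinset_univ] at h2
  exact h2.symm

/-- The mean displacement vanishes at zero Péclet number. -/
theorem sum_prod_nu_mul_displacement (β : ℝ) (K : ℕ) :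
    ∑ u : Fin K → Fin 3, (∏ d, nu β 0 (u d)) * ∑ d, (1 - ((u d : ℕ) : ℝ)) = 0 := by
  have h := Equiv.sum_comp (Equiv.piCongrRight fun _ : Fin K => (Fin.revPerm : Equiv.Perm (Fin 3)))
    (fun u : Fin K → Fin 3 => (∏ d, nu β 0 (u d)) * ∑ d, (1 - ((u d : ℕ) : ℝ)))
  have e1 (x : Fin 3) : nu β 0 x.rev = nu β 0 x := by
    fin_cases x <;> simp [nu, Fin.rev]
  have e2 (x : Fin 3) : (1 : ℝ) - ((x.rev : ℕ) : ℝ) = -(1 - ((x : ℕ) : ℝ)) := by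
    fin_cases x <;> simp [Fin.rev] <;> norm_num
  simp only [Equiv.piCongrRight_apply, Pi.map_apply, Fin.revPerm_apply, e1, e2,
    Finset.sum_neg_distrib, mul_neg] at h
  linarith

theorem continuous_nu (β D v : ℝ) (u : Fin 3) : Continuous fun h : ℝ => nu β (v * h / D) u := by
  unfold nu
  split_ifs <;> fun_prop

/-- Averaging over the digits a family whose expansion starts at first order with coefficients
that cancel on average, and whose second-order coefficients are affine in the displacement. -/
theorem tendsto_average (β D v : ℝ) {K : ℕ} (G : Fin 3 → (Fin K → Fin 3) → ℝ → ℝ)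
    (g₁ g₂ g₃ : Fin 3 → ℝ)
    (hG : ∀ u₀ u', HasJetTwo (G u₀ u') 0 (g₁ u₀)
      (g₂ u₀ + (∑ d, (1 - ((u' d : ℕ) : ℝ))) * g₃ u₀))
    (hmid : g₁ 1 = 0) (hrefl : g₁ 0 + g₁ 2 = 0) :
    Tendsto (fun h => (∑ u₀ : Fin 3, ∑ u' : Fin K → Fin 3,
        nu β (v * h / D) u₀ * (∏ d, nu β (v * h / D) (u' d)) * G u₀ u' h) / h ^ 2)
      (nhdsWithin 0 (Set.Ioi 0))
      (nhds (β * (v / D) / 2 * g₁ 0 + β / 2 * (g₂ 0 + g₂ 2) + (1 - β) * g₂ 1)) := by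
  choose e he hGe using hG
  set W : ℝ → ℝ := fun h => ∑ u : Fin K → Fin 3,
    (∏ d, nu β (v * h / D) (u d)) * ∑ d, (1 - ((u d : ℕ) : ℝ)) with hWdef
  have hcp (u : Fin K → Fin 3) : Continuous fun h : ℝ => ∏ d, nu β (v * h / D) (u d) :=
    continuous_finsetProd _ fun d _ => continuous_nu β D v (u d)
  have hνt (u : Fin 3) : Tendsto (fun h : ℝ => nu β (v * h / D) u)
      (nhdsWithin 0 (Set.Ioi 0)) (nhds (nu β 0 u)) := by
    have := (continuous_nu β D v u).tendsto 0
    simp only [mul_zero, zero_div] at this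
    exact this.mono_left nhdsWithin_le_nhds
  have hW : Tendsto W (nhdsWithin 0 (Set.Ioi 0)) (nhds 0) := by
    have hc : Continuous W := continuous_finsetSum _ fun u _ => (hcp u).mul continuous_const
    have h0 : W 0 = 0 := by
      simp only [hWdef, mul_zero, zero_div]
      exact sum_prod_nu_mul_displacement β K
    have := hc.tendsto 0
    rw [h0] at this
    exact this.mono_left nhdsWithin_le_nhds
  have hR : Tendsto (fun h => ∑ u₀ : Fin 3, nu β (v * h / D) u₀ *
      (g₂ u₀ + g₃ u₀ * W h + ∑ u' : Fin K → Fin 3, (∏ d, nu β (v * h / D) (u' d)) * e u₀ u' h))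
      (nhdsWithin 0 (Set.Ioi 0)) (nhds (∑ u₀ : Fin 3, nu β 0 u₀ * g₂ u₀)) := by
    refine tendsto_finsetSum _ fun u₀ _ => (hνt u₀).mul ?_
    have hs : Tendsto (fun h => ∑ u' : Fin K → Fin 3,
        (∏ d, nu β (v * h / D) (u' d)) * e u₀ u' h) (nhdsWithin 0 (Set.Ioi 0))
        (nhds (∑ u' : Fin K → Fin 3, (∏ d, nu β (v * 0 / D) (u' d)) * 0)) :=
      tendsto_finsetSum _ fun u' _ =>
        (((hcp u').tendsto 0).mono_left nhdsWithin_le_nhds).mul (he u₀ u')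
    simpa using ((hW.const_mul (g₃ u₀)).const_add (g₂ u₀)).add hs
  have hlim := hR.const_add (β * (v / D) / 2 * g₁ 0)
  have hval : β * (v / D) / 2 * g₁ 0 + ∑ u₀ : Fin 3, nu β 0 u₀ * g₂ u₀ =
      β * (v / D) / 2 * g₁ 0 + β / 2 * (g₂ 0 + g₂ 2) + (1 - β) * g₂ 1 := by
    simp [Fin.sum_univ_three, nu]; ring
  rw [hval] at hlim
  refine hlim.congr' ?_
  have hall : ∀ᶠ h in nhdsWithin (0 : ℝ) (Set.Ioi 0), ∀ u₀ u', G u₀ u' h =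
      0 + g₁ u₀ * h + (g₂ u₀ + (∑ d, (1 - ((u' d : ℕ) : ℝ))) * g₃ u₀) * h ^ 2
        + h ^ 2 * e u₀ u' h :=
    eventually_all.mpr fun u₀ => eventually_all.mpr fun u' => hGe u₀ u'
  filter_upwards [hall, self_mem_nhdsWithin] with h hh hpos
  have h0 : h ≠ 0 := ne_of_gt hpos
  have hinner (u₀ : Fin 3) : ∑ u' : Fin K → Fin 3,
      nu β (v * h / D) u₀ * (∏ d, nu β (v * h / D) (u' d)) * G u₀ u' h =
      nu β (v * h / D) u₀ * (g₁ u₀ * h) + h ^ 2 * (nu β (v * h / D) u₀ *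
        (g₂ u₀ + g₃ u₀ * W h
          + ∑ u' : Fin K → Fin 3, (∏ d, nu β (v * h / D) (u' d)) * e u₀ u' h)) := by
    have hone := sum_prod_nu β (v * h / D) K
    calc _ = ∑ u' : Fin K → Fin 3, (
          (nu β (v * h / D) u₀ * (g₁ u₀ * h + g₂ u₀ * h ^ 2)) * (∏ d, nu β (v * h / D) (u' d))
          + (h ^ 2 * nu β (v * h / D) u₀ * g₃ u₀) *
            ((∏ d, nu β (v * h / D) (u' d)) * ∑ d, (1 - ((u' d : ℕ) : ℝ)))
          + (h ^ 2 * nu β (v * h / D) u₀) *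
            ((∏ d, nu β (v * h / D) (u' d)) * e u₀ u' h)) := by
          refine Finset.sum_congr rfl fun u' _ => ?_
          rw [hh u₀ u']; ring
      _ = _ := by
          rw [Finset.sum_add_distrib, Finset.sum_add_distrib, ← Finset.mul_sum,
            ← Finset.mul_sum, ← Finset.mul_sum, hone]
          simp only [hWdef]
          ring
  simp only [hinner]
  rw [Finset.sum_add_distrib, ← Finset.mul_sum, add_div, mul_div_cancel_left₀ _ (by positivity)]
  congr 1
  have h2 : g₁ 2 = -g₁ 0 := by linarith
  simp only [Fin.sum_univ_three, hmid, h2]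
  simp [nu]
  field_simp
  ring

/-- In the antisymmetric case only the moving trits contribute to the sum over `ω`. -/
theorem Ksum_one_neg_one_of_odd (D v β r : ℝ) (k : ℕ) (ρ₀ : ℝ → ℝ) (f : ℝ → ℝ → ℝ) {m : ℕ}
    (hm : Odd m) (h : ℝ) :
    Ksum D v β r k ρ₀ f 1 (-1) m h = h * (β * (v * h / D) / 2) *
      ∑ u₀ : Fin 3, ∑ u' : Fin (k - 1) → Fin 3,
        nu β (v * h / D) u₀ * (∏ d, nu β (v * h / D) (u' d)) *
          (Floc β (v * h / D) r h ρ₀ f 0 2 u₀ u' - Floc β (v * h / D) r h ρ₀ f (-1) 2 u₀ u'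
            - Floc β (v * h / D) r h ρ₀ f 0 0 u₀ u' + Floc β (v * h / D) r h ρ₀ f 1 0 u₀ u') := by
  have h0 : eta β (v * h / D) 0 + -1 * nu β (v * h / D) 0 = -(β * (v * h / D) / 2) := by
    simp only [eta, nu, Fin.val_zero, if_true]; ring
  have h1 : eta β (v * h / D) 1 + -1 * nu β (v * h / D) 1 = 0 := by
    simp [eta, nu]
  have h2 : eta β (v * h / D) 2 + -1 * nu β (v * h / D) 2 = β * (v * h / D) / 2 := by
    simp [eta, nu]; ring
  unfold Ksum
  rw [Fin.sum_univ_three, h0, h1, h2, hm.neg_one_pow, mul_assoc h]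
  congr 1
  simp only [Finset.mul_sum, ← Finset.sum_add_distrib]
  refine Finset.sum_congr rfl fun u₀ _ => Finset.sum_congr rfl fun u' _ => ?_
  have e0 : (1 : ℤ) - (((0 : Fin 3) : ℕ) : ℤ) = 1 := by simp
  have e2 : (1 : ℤ) - (((2 : Fin 3) : ℕ) : ℤ) = -1 := by simp
  rw [e0, e2]
  ring

/-- Leading-order form, Case II-2: if m = 2m′+1 is odd with m′ > 0, ε = 1 and δ = −1,
then lim_{Δr→0⁺} Δr^(−(m+1))·⟨A⟩(Δr) = L as given by `LII2`. -/
theorem leading_form_II2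
    (D v β r : ℝ) (k : ℕ) (ρ₀ : ℝ → ℝ) (f : ℝ → ℝ → ℝ)
    (ε δ : ℝ) (m : ℕ) (Chat : ℝ → ℝ)
    (hD : 0 < D) (hβ0 : 0 < β) (hβ1 : β < 1) (hk : 1 ≤ k)
    (hρ : ContDiff ℝ (⊤ : ℕ∞) ρ₀) (hρpos : ∀ x, 0 < ρ₀ x)
    (hf : ContDiff ℝ (⊤ : ℕ∞) (Function.uncurry f))
    (hε : ε = 1 ∨ ε = -1) (hδ : δ = 1 ∨ δ = -1)
    (hsym : ∀ x y, f y x = (-1 : ℝ) ^ m * f x y)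
    (hlow : ∀ Y : ℝ, ∀ j < m, iteratedDeriv j (fun X => ftilde f X Y) 0 = 0)
    (hchar : ∀ Y : ℝ, iteratedDeriv m (fun X => ftilde f X Y) 0 = (m.factorial : ℝ) * Chat Y)
    (hCbdd : ∃ M : ℝ, ∀ y, |Chat y| ≤ M) (hCne : ∀ y, Chat y ≠ 0)
    (m' : ℕ) (hm : m = 2 * m' + 1) (hm' : 0 < m') (hε1 : ε = 1) (hδm1 : δ = -1) :
    Filter.Tendsto
      (fun Δr : ℝ => Δr ^ (-((m : ℤ) + 1)) * avgA D v β r k ρ₀ f ε δ m Δr)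
      (nhdsWithin 0 (Set.Ioi 0)) (nhds (LII2 D v β r ρ₀ Chat m m')) := by
  obtain ⟨M, rfl⟩ : ∃ M, m' = M + 1 := ⟨m' - 1, by omega⟩
  subst hε1 hδm1 hm
  have hodd : Odd (2 * M + 1) := odd_two_mul_add_one M
  have hpar : (-1 : ℝ) ^ (2 * (M + 1) + 1) = -1 := Odd.neg_one_pow (odd_two_mul_add_one _)
  have hF (j : ℤ) (ω u₀ : Fin 3) (u' : Fin (k - 1) → Fin 3) :=
    hasJetTwo_Floc (D := D) (v := v) (r := r) (Chat := Chat) hβ0 hβ1 hρ hf hodd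
      (fun x y => by rw [hsym, hpar, neg_one_mul]) hlow hchar j ω u₀ u'
  set a := v / D with ha
  set B := iteratedDeriv (2 * M + 1 + 2 + 2) (fun X => ftilde f X (ρ₀ r)) 0
    / ((2 * M + 1 + 2 + 2).factorial : ℝ) with hB
  set P : ℝ → ℝ → ℝ := fun c t => xZero a (ρ₀ r) (deriv ρ₀ r) c t ^ (2 * M + 1) with hPdef
  have hneg (t : ℝ) : P 1 t = -P (-1) (-t) := by
    simp only [hPdef]
    rw [← Odd.neg_pow hodd]
    congr 1
    simp only [xZero]; ring
  have hG (u₀ : Fin 3) (u' : Fin (k - 1) → Fin 3) :=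
    (((hF 0 2 u₀ u').add ((hF (-1) 2 u₀ u').const_mul (-1))).add
      ((hF 0 0 u₀ u').const_mul (-1))).add (hF 1 0 u₀ u')
  have hlim := tendsto_average β D v _
    (fun u₀ => bracketOne a (ρ₀ r) (deriv ρ₀ r) (iteratedDeriv 2 ρ₀ r) (Chat (ρ₀ r))
      (deriv Chat (ρ₀ r)) (2 * M + 1 + 2) (P (-1) (1 - ((u₀ : ℕ) : ℝ)))
      (P 1 (1 - ((u₀ : ℕ) : ℝ))) (1 - ((u₀ : ℕ) : ℝ)) 0)
    (fun u₀ => bracketTwo a (ρ₀ r) (deriv ρ₀ r) (iteratedDeriv 2 ρ₀ r) (iteratedDeriv 3 ρ₀ r)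
      (Chat (ρ₀ r)) (deriv Chat (ρ₀ r)) (iteratedDeriv 2 Chat (ρ₀ r)) B (2 * M + 1 + 2)
      (P (-1) (1 - ((u₀ : ℕ) : ℝ))) (P 1 (1 - ((u₀ : ℕ) : ℝ))) (1 - ((u₀ : ℕ) : ℝ)) 0)
    (fun u₀ => bracketTwo a (ρ₀ r) (deriv ρ₀ r) (iteratedDeriv 2 ρ₀ r) (iteratedDeriv 3 ρ₀ r)
        (Chat (ρ₀ r)) (deriv Chat (ρ₀ r)) (iteratedDeriv 2 Chat (ρ₀ r)) B (2 * M + 1 + 2)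
        (P (-1) (1 - ((u₀ : ℕ) : ℝ))) (P 1 (1 - ((u₀ : ℕ) : ℝ))) (1 - ((u₀ : ℕ) : ℝ)) 1
      - bracketTwo a (ρ₀ r) (deriv ρ₀ r) (iteratedDeriv 2 ρ₀ r) (iteratedDeriv 3 ρ₀ r)
        (Chat (ρ₀ r)) (deriv Chat (ρ₀ r)) (iteratedDeriv 2 Chat (ρ₀ r)) B (2 * M + 1 + 2)
        (P (-1) (1 - ((u₀ : ℕ) : ℝ))) (P 1 (1 - ((u₀ : ℕ) : ℝ))) (1 - ((u₀ : ℕ) : ℝ)) 0)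
    (fun u₀ u' => by
      rw [← bracketTwo_displacement, ← bracketOne_displacement _ _ _ _ _ _ _ _ _ _
        (∑ d, (1 - ((u' d : ℕ) : ℝ)))]
      convert hG u₀ u' using 1
      · ring
      · simp only [bracketOne, hPdef]
        norm_num
        ring
      · simp only [bracketTwo, hPdef]
        norm_num
        ring)
    (by
      simp [hneg]
      exact bracketOne_middle _ _ _ _ _ _ _ _)
    (by
      simp [hneg]
      norm_num
      exact bracketOne_reflect _ _ _ _ _ _ _ _ _)
  rw [LII2_eq_bracket D v β r ρ₀ Chat M B (P := P (-1) 1) (Q := P (-1) (-1)) (S := P (-1) 0)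
    rfl rfl rfl]
  have hlim' := hlim.const_mul v
  convert hlim'.congr' ?_ using 2
  · simp [hneg]
    norm_num
    exact Or.inl rfl
  · filter_upwards [self_mem_nhdsWithin] with h hh
    have hh0 : h ≠ 0 := ne_of_gt hh
    have hpow : h ^ (-(((2 * (M + 1) + 1 : ℕ) : ℤ) + 1)) = (h ^ (2 * M + 1 + 2 + 1))⁻¹ := by
      rw [zpow_neg, ← zpow_natCast]
      congr 2
    rw [avgA, Ksum_one_neg_one_of_odd D v β r k ρ₀ f (odd_two_mul_add_one _), hpow]
    have hsum : ∀ S T : ℝ, T = S / h ^ (2 * M + 1 + 2) →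
        v * (T / h ^ 2) = (h ^ (2 * M + 1 + 2 + 1))⁻¹ *
          (h * (β * (v * h / D) / 2) * S / (β * h ^ 2 / (2 * D) * h)) := by
      rintro S _ rfl
      field_simp
      ring
    refine hsum _ _ ?_
    simp only [Finset.sum_div]
    refine Finset.sum_congr rfl fun u₀ _ => Finset.sum_congr rfl fun u' _ => ?_
    ring
end
end

section
/- β-independence of macroscopically observable limits: suppose (m, ε, δ) is such that the LOE exponent equals 0, i.e. (m = 0 and (ε,δ) ≠ (1,1)), or (m = 2 and ε = δ = 1), or (m = 1 and (ε = −1 or δ = 1)). Write ⟨A⟩_β(Δr) for the averaged quantity built with the parameter β. Then for every β ∈ (0,1) the limit lim_{Δr→0⁺} ⟨A⟩_β(Δr) exists, and this limit is the same real number for all β ∈ (0,1); i.e., the macroscopic (continuum-limit) value of an observable averaged T¹-type quantity is independent of the coarse-graining parameter β. -/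
open Filter Finset

noncomputable section

open Topology

lemma taylor_two_along {E : Type*} [NormedAddCommGroup E] [NormedSpace ℝ E] {G : E → ℝ}
    (hG : ContDiffAt ℝ 2 G 0) (w : E) :
    Tendsto (fun h : ℝ => (G (h • w) - (G 0 + h * fderiv ℝ G 0 w +
      h ^ 2 * (fderiv ℝ (fderiv ℝ G) 0 w w / 2))) / h ^ 2) (𝓝[>] 0) (𝓝 0) := by
  have hline : ∀ t : ℝ, HasDerivAt (fun h : ℝ => h • w) w t := fun t => by
    simpa using (hasDerivAt_id t).smul_const w
  have hcont : Tendsto (fun h : ℝ => h • w) (𝓝 0) (𝓝 (0 : E)) := by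
    simpa using (hline 0).continuousAt.tendsto
  have hdiff : ∀ᶠ h : ℝ in 𝓝 0, DifferentiableAt ℝ G (h • w) :=
    hcont.eventually ((hG.eventually (by simp)).mono fun x hx => hx.differentiableAt (by simp))
  have hsecond : HasDerivAt (fun h : ℝ => fderiv ℝ G (h • w) w)
      (fderiv ℝ (fderiv ℝ G) 0 w w) 0 := by
    have h1 : DifferentiableAt ℝ (fderiv ℝ G) 0 :=
      (hG.fderiv_right (m := 1) (by norm_num)).differentiableAt (by simp)
    have h2 : HasFDerivAt (fderiv ℝ G) (fderiv ℝ (fderiv ℝ G) 0) ((0 : ℝ) • w) := by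
      simpa using h1.hasFDerivAt
    have h3 : HasDerivAt (fun h : ℝ => fderiv ℝ G (h • w)) (fderiv ℝ (fderiv ℝ G) 0 w) 0 :=
      h2.comp_hasDerivAt (0 : ℝ) (hline 0)
    exact (ContinuousLinearMap.apply ℝ ℝ w).hasFDerivAt.comp_hasDerivAt (0 : ℝ) h3
  obtain ⟨s, hs, hball⟩ := Metric.eventually_nhds_iff_ball.1 hdiff
  have hmem : (0 : ℝ) ∈ Metric.ball (0 : ℝ) s := Metric.mem_ball_self hs
  have hlittle := Convex.isLittleO_pow_succ_real (n := 1)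
    (f := fun h : ℝ => G (h • w) - (G 0 + h * fderiv ℝ G 0 w +
      h ^ 2 * (fderiv ℝ (fderiv ℝ G) 0 w w / 2)))
    (f' := fun h : ℝ => fderiv ℝ G (h • w) w - (fderiv ℝ G 0 w +
      h * fderiv ℝ (fderiv ℝ G) 0 w w))
    (convex_ball (0 : ℝ) s) hmem (fun t ht => by
      have h1 := (hball t ht).hasFDerivAt.comp_hasDerivAt t (hline t)
      have h2 := (((hasDerivAt_id t).mul_const (fderiv ℝ G 0 w)).const_add (G 0)).add
        (((hasDerivAt_id t).pow 2).mul_const (fderiv ℝ (fderiv ℝ G) 0 w w / 2))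
      refine ((h1.sub h2).congr_deriv ?_).hasDerivWithinAt
      simp
      ring) (by
      have := (hasDerivAt_iff_isLittleO.1 hsecond).mono
        (nhdsWithin_le_nhds (s := Metric.ball (0 : ℝ) s))
      refine this.congr (fun t => ?_) (fun t => by simp)
      simp
      ring)
  rw [Metric.isOpen_ball.nhdsWithin_eq hmem] at hlittle
  refine ((hlittle.mono (nhdsWithin_le_nhds (s := Set.Ioi 0))).tendsto_div_nhds_zero).congr
    fun h => ?_
  simp

/-- Second-order expansion of `G` along `(h • w, h)`: the first-order part in `w` and the part
quadratic in `w` depend only on the restriction of `G` to `E × {0}`. -/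
lemma exists_expansion_prod {E : Type*} [NormedAddCommGroup E] [NormedSpace ℝ E]
    {G : E × ℝ → ℝ} (hG : ContDiffAt ℝ 2 G 0) :
    ∃ (c₁ c₂ : ℝ) (l : E →L[ℝ] ℝ), ∀ w : E,
      Tendsto (fun h : ℝ => (G (h • w, h) - (G 0 + h * (fderiv ℝ (fun w => G (w, 0)) 0 w + c₁) +
        h ^ 2 * (fderiv ℝ (fderiv ℝ (fun w => G (w, 0))) 0 w w / 2 + l w + c₂))) / h ^ 2)
        (𝓝[>] 0) (𝓝 0) := by
  let ι := ContinuousLinearMap.inl ℝ E ℝ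
  have hfirst : ∀ᶠ w : E in 𝓝 0, fderiv ℝ (fun w => G (w, 0)) w = (fderiv ℝ G (ι w)).comp ι := by
    have hι : Tendsto ι (𝓝 0) (𝓝 0) := by simpa using ι.continuous.tendsto 0
    filter_upwards [hι.eventually (hG.eventually (by simp))] with w hw
    exact ((hw.differentiableAt (by simp)).hasFDerivAt.comp w ι.hasFDerivAt).fderiv
  have hsecond : ∀ w, fderiv ℝ (fderiv ℝ (fun w => G (w, 0))) 0 w w =
      fderiv ℝ (fderiv ℝ G) 0 (ι w) (ι w) := fun w => by
    have h1 : DifferentiableAt ℝ (fderiv ℝ G) (ι 0) := by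
      simpa using (hG.fderiv_right (m := 1) (by norm_num)).differentiableAt (by simp)
    have h2 := (h1.hasFDerivAt.comp 0 ι.hasFDerivAt).clm_comp (hasFDerivAt_const ι (0 : E))
    rw [(h2.congr_of_eventuallyEq hfirst).fderiv]
    simp
  set Q := fderiv ℝ (fderiv ℝ G) 0
  refine ⟨fderiv ℝ G 0 (0, 1), Q (0, 1) (0, 1) / 2,
    (1 / 2 : ℝ) • ((Q (0, 1)).comp ι + (Q.flip (0, 1)).comp ι), fun w => ?_⟩
  refine (taylor_two_along hG (w, 1)).congr fun h => ?_
  have hw : ((w, 1) : E × ℝ) = ι w + (0, 1) := by simp [ι]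
  rw [hsecond, hfirst.self_of_nhds, Prod.smul_mk, smul_eq_mul, mul_one, hw]
  simp only [map_add, ContinuousLinearMap.comp_apply, add_apply,
    smul_apply, ContinuousLinearMap.flip_apply, map_zero, smul_eq_mul]
  change (_ - (_ + _ + h ^ 2 * ((Q _ _ + Q _ _ + (Q _ _ + Q _ _)) / 2))) / _ = _
  ring

/-- The ratio `η/ν` as a function of the displacement `x = (1 - ω)·Δr`, with `a = v/D`. -/
def ratio (a x : ℝ) : ℝ := (1 - a * x / 2) / (1 + a * x / 2)

/-- The bulk density at displacement `y`, with the grid size `t` entering through the string `u`. -/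
def density (a r : ℝ) (ρ₀ : ℝ → ℝ) {K : ℕ} (u : Fin K → Fin 3) (y t : ℝ) : ℝ :=
  (∏ d, ratio a ((1 - ((u d : ℕ) : ℝ)) * t)) *
    ρ₀ (r + y + (∑ d, (1 - ((u d : ℕ) : ℝ))) * t)

/-- `Floc` as a smooth function of the displacements of `ω`, of `j`, of `u₀`, and the grid size. -/
def pairField (a r : ℝ) (ρ₀ : ℝ → ℝ) (f : ℝ → ℝ → ℝ) {K : ℕ} (u : Fin K → Fin 3)
    (p : (ℝ × ℝ × ℝ) × ℝ) : ℝ :=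
  f (ratio a p.1.1 * density a r ρ₀ u p.1.2.1 p.2)
    (ratio a p.1.2.2 * density a r ρ₀ u (p.1.2.1 + p.1.2.2) p.2)

lemma ratio_zero (a : ℝ) : ratio a 0 = 1 := by simp [ratio]

lemma eta_div_nu {β : ℝ} (h0 : 0 < β) (h1 : β < 1) (D v h : ℝ) (ω : Fin 3) :
    eta β (v * h / D) ω / nu β (v * h / D) ω = ratio (v / D) ((1 - ((ω : ℕ) : ℝ)) * h) := by
  have hβ : β / 2 ≠ 0 := by positivity
  have hβ' : 1 - β ≠ 0 := by linarith
  fin_cases ω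
  · simp only [eta, nu, ratio, if_true]
    rw [mul_div_mul_left _ _ hβ]
    norm_num
    ring_nf
  · simp [eta, nu, ratio, hβ']
  · simp only [eta, nu, ratio]
    norm_num
    rw [mul_div_mul_left _ _ hβ]
    ring_nf

lemma Floc_eq_pairField {β : ℝ} (h0 : 0 < β) (h1 : β < 1) (D v r h : ℝ) (ρ₀ : ℝ → ℝ)
    (f : ℝ → ℝ → ℝ) {K : ℕ} (j : ℤ) (ω u₀ : Fin 3) (u : Fin K → Fin 3) :
    Floc β (v * h / D) r h ρ₀ f j ω u₀ u =
      pairField (v / D) r ρ₀ f u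
        (h • (1 - ((ω : ℕ) : ℝ), (j : ℝ), 1 - ((u₀ : ℕ) : ℝ)), h) := by
  simp only [Floc, rhoHat, pairField, density, eta_div_nu h0 h1, Prod.smul_mk, smul_eq_mul]
  rw [mul_comm h (1 - ((ω : ℕ) : ℝ)), mul_comm h (1 - ((u₀ : ℕ) : ℝ))]
  push_cast
  congr 4 <;> ring_nf

lemma contDiffAt_ratio (a : ℝ) : ContDiffAt ℝ 2 (ratio a) 0 := by
  unfold ratio
  refine ContDiffAt.div (by fun_prop) (by fun_prop) (by simp)

lemma contDiffAt_density (a r : ℝ) {ρ₀ : ℝ → ℝ} (hρ : ContDiff ℝ 2 ρ₀) {K : ℕ}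
    (u : Fin K → Fin 3) : ContDiffAt ℝ 2 (fun q : ℝ × ℝ => density a r ρ₀ u q.1 q.2) 0 := by
  unfold density
  refine ContDiffAt.mul (contDiffAt_prod fun d _ => ?_) ?_
  · refine ContDiffAt.comp (0 : ℝ × ℝ) (g := ratio a)
      (f := fun q : ℝ × ℝ => (1 - ((u d : ℕ) : ℝ)) * q.2) ?_ (by fun_prop)
    simpa using contDiffAt_ratio a
  · exact hρ.contDiffAt.comp (0 : ℝ × ℝ) (by fun_prop)

lemma contDiffAt_pairField (a r : ℝ) {ρ₀ : ℝ → ℝ} (hρ : ContDiff ℝ 2 ρ₀) {f : ℝ → ℝ → ℝ}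
    (hf : ContDiff ℝ 2 (Function.uncurry f)) {K : ℕ} (u : Fin K → Fin 3) :
    ContDiffAt ℝ 2 (pairField a r ρ₀ f u) 0 := by
  have hd : ∀ g : (ℝ × ℝ × ℝ) × ℝ → ℝ × ℝ, ContDiff ℝ 2 g → g 0 = 0 →
      ContDiffAt ℝ 2 (fun p => density a r ρ₀ u (g p).1 (g p).2) 0 := fun g hg hg0 =>
    ContDiffAt.comp (0 : (ℝ × ℝ × ℝ) × ℝ) (g := fun q : ℝ × ℝ => density a r ρ₀ u q.1 q.2)
      (by rw [hg0]; exact contDiffAt_density a r hρ u) hg.contDiffAt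
  have hr : ∀ g : (ℝ × ℝ × ℝ) × ℝ → ℝ, ContDiff ℝ 2 g → g 0 = 0 →
      ContDiffAt ℝ 2 (fun p => ratio a (g p)) 0 := fun g hg hg0 =>
    ContDiffAt.comp (0 : (ℝ × ℝ × ℝ) × ℝ) (g := ratio a)
      (by rw [hg0]; exact contDiffAt_ratio a) hg.contDiffAt
  refine ContDiffAt.comp (0 : (ℝ × ℝ × ℝ) × ℝ) (g := Function.uncurry f)
    (f := fun p : (ℝ × ℝ × ℝ) × ℝ => (ratio a p.1.1 * density a r ρ₀ u p.1.2.1 p.2,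
      ratio a p.1.2.2 * density a r ρ₀ u (p.1.2.1 + p.1.2.2) p.2)) hf.contDiffAt ?_
  refine ContDiffAt.prodMk (ContDiffAt.mul ?_ ?_) (ContDiffAt.mul ?_ ?_)
  · exact hr (fun p => p.1.1) (by fun_prop) rfl
  · exact hd (fun p => (p.1.2.1, p.2)) (by fun_prop) rfl
  · exact hr (fun p => p.1.2.2) (by fun_prop) rfl
  · exact hd (fun p => (p.1.2.1 + p.1.2.2, p.2)) (by fun_prop) (by simp)

/-- At grid size zero the field does not depend on the string. -/
lemma pairField_zero_right (a r : ℝ) (ρ₀ : ℝ → ℝ) (f : ℝ → ℝ → ℝ) {K : ℕ} (u : Fin K → Fin 3)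
    (w : ℝ × ℝ × ℝ) :
    pairField a r ρ₀ f u (w, 0) =
      f (ratio a w.1 * ρ₀ (r + w.2.1)) (ratio a w.2.2 * ρ₀ (r + (w.2.1 + w.2.2))) := by
  simp [pairField, density, ratio_zero]

lemma pairField_diagonal (a r : ℝ) (ρ₀ : ℝ → ℝ) {f : ℝ → ℝ → ℝ} (hf : ∀ x, f x x = 0) {K : ℕ}
    (u : Fin K → Fin 3) (j h : ℝ) : pairField a r ρ₀ f u (h • (0, j, 0), h) = 0 := by
  simp [pairField, ratio_zero, hf]

/-- A quadratic polynomial in `h`, with coefficients polynomial in `(s, j, σ)`. -/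
def jet (f₀ : ℝ) (a : Fin 3 → ℝ) (b : Fin 3 → Fin 3 → ℝ) (c : Fin 2 → ℝ) (l : Fin 3 → ℝ)
    (s j σ h : ℝ) : ℝ :=
  f₀ + h * (a 0 * s + a 1 * j + a 2 * σ + c 0) +
    h ^ 2 * (b 0 0 * s ^ 2 + b 1 1 * j ^ 2 + b 2 2 * σ ^ 2 + b 0 1 * (s * j) + b 0 2 * (s * σ) +
      b 1 2 * (j * σ) + (l 0 * s + l 1 * j + l 2 * σ) + c 1)

lemma exists_jet_pairField (a r : ℝ) {ρ₀ : ℝ → ℝ} (hρ : ContDiff ℝ 2 ρ₀) {f : ℝ → ℝ → ℝ}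
    (hf : ContDiff ℝ 2 (Function.uncurry f)) (K : ℕ) :
    ∃ (f₀ : ℝ) (A : Fin 3 → ℝ) (B : Fin 3 → Fin 3 → ℝ), ∀ u : Fin K → Fin 3,
      ∃ (c : Fin 2 → ℝ) (l : Fin 3 → ℝ), ∀ s j σ : ℝ,
        Tendsto (fun h : ℝ => (pairField a r ρ₀ f u (h • (s, j, σ), h) - jet f₀ A B c l s j σ h) /
          h ^ 2) (𝓝[>] 0) (𝓝 0) := by
  let G : ℝ × ℝ × ℝ → ℝ := fun w =>
    f (ratio a w.1 * ρ₀ (r + w.2.1)) (ratio a w.2.2 * ρ₀ (r + (w.2.1 + w.2.2)))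
  let e : Fin 3 → ℝ × ℝ × ℝ := ![(1, 0, 0), (0, 1, 0), (0, 0, 1)]
  let Q := fderiv ℝ (fderiv ℝ G) 0
  have hw : ∀ s j σ : ℝ, ((s, j, σ) : ℝ × ℝ × ℝ) = s • e 0 + j • e 1 + σ • e 2 := by
    intro s j σ
    simp [e]
  refine ⟨G 0, fun i => fderiv ℝ G 0 (e i), fun i k => if i = k then Q (e i) (e i) / 2 else
    (Q (e i) (e k) + Q (e k) (e i)) / 2, fun u => ?_⟩
  obtain ⟨c₁, c₂, l, hl⟩ := exists_expansion_prod (contDiffAt_pairField a r hρ hf u)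
  have hG : (fun w => pairField a r ρ₀ f u (w, 0)) = G :=
    funext (pairField_zero_right a r ρ₀ f u)
  have hG0 : pairField a r ρ₀ f u 0 = G 0 := congrFun hG 0
  refine ⟨![c₁, c₂], fun i => l (e i), fun s j σ => (hl (s, j, σ)).congr fun h => ?_⟩
  have hA : fderiv ℝ G 0 (s, j, σ) =
      s * fderiv ℝ G 0 (e 0) + j * fderiv ℝ G 0 (e 1) + σ * fderiv ℝ G 0 (e 2) := by
    rw [hw]; simp only [map_add, map_smul, smul_eq_mul]
  have hL : l (s, j, σ) = s * l (e 0) + j * l (e 1) + σ * l (e 2) := by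
    rw [hw]; simp only [map_add, map_smul, smul_eq_mul]
  have hQ : Q (s, j, σ) (s, j, σ) =
      s * (s * Q (e 0) (e 0) + j * Q (e 0) (e 1) + σ * Q (e 0) (e 2)) +
      j * (s * Q (e 1) (e 0) + j * Q (e 1) (e 1) + σ * Q (e 1) (e 2)) +
      σ * (s * Q (e 2) (e 0) + j * Q (e 2) (e 1) + σ * Q (e 2) (e 2)) := by
    rw [hw]; simp only [map_add, map_smul, smul_eq_mul, add_apply, smul_apply]; ring
  rw [hG, hG0, hA, hL, hQ]
  simp [jet]
  ring

/-- The part of `K/Δr` belonging to a fixed string `u₁…u_{k-1}`, for a general field `N`. -/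
def digitSum (a β δ e : ℝ) (N : ℝ → ℝ → ℝ → ℝ → ℝ) (h : ℝ) : ℝ :=
  ∑ ω : Fin 3, ∑ u₀ : Fin 3, (eta β (a * h) ω + δ * nu β (a * h) ω) * nu β (a * h) u₀ *
    (N (1 - ((ω : ℕ) : ℝ)) 0 (1 - ((u₀ : ℕ) : ℝ)) h +
      e * N (1 - ((ω : ℕ) : ℝ)) (1 - ((ω : ℕ) : ℝ)) (1 - ((u₀ : ℕ) : ℝ)) h)

lemma continuous_eta (β : ℝ) (ω : Fin 3) : Continuous fun x => eta β x ω := by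
  unfold eta; split_ifs <;> fun_prop

lemma continuous_nu_s13 (β : ℝ) (ω : Fin 3) : Continuous fun x => nu β x ω := by
  unfold nu; split_ifs <;> fun_prop

lemma sum_nu (β x : ℝ) : ∑ ω, nu β x ω = 1 := by
  simp [Fin.sum_univ_three, nu]; ring

lemma tendsto_digitSum_sub {a β δ e : ℝ} {N J : ℝ → ℝ → ℝ → ℝ → ℝ}
    (hN : ∀ s j σ, Tendsto (fun h => (N s j σ h - J s j σ h) / h ^ 2) (𝓝[>] 0) (𝓝 0)) :
    Tendsto (fun h => digitSum a β δ e N h / h ^ 2 - digitSum a β δ e J h / h ^ 2)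
      (𝓝[>] 0) (𝓝 0) := by
  have hlim : Tendsto (fun h => ∑ ω : Fin 3, ∑ u₀ : Fin 3,
      (eta β (a * h) ω + δ * nu β (a * h) ω) * nu β (a * h) u₀ *
      ((N (1 - ((ω : ℕ) : ℝ)) 0 (1 - ((u₀ : ℕ) : ℝ)) h -
          J (1 - ((ω : ℕ) : ℝ)) 0 (1 - ((u₀ : ℕ) : ℝ)) h) / h ^ 2 +
        e * ((N (1 - ((ω : ℕ) : ℝ)) (1 - ((ω : ℕ) : ℝ)) (1 - ((u₀ : ℕ) : ℝ)) h -
          J (1 - ((ω : ℕ) : ℝ)) (1 - ((ω : ℕ) : ℝ)) (1 - ((u₀ : ℕ) : ℝ)) h) / h ^ 2)))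
      (𝓝[>] 0) (𝓝 (∑ ω : Fin 3, ∑ u₀ : Fin 3,
        (eta β (a * 0) ω + δ * nu β (a * 0) ω) * nu β (a * 0) u₀ * (0 + e * 0))) := by
    refine tendsto_finsetSum _ fun ω _ => tendsto_finsetSum _ fun u₀ _ => ?_
    have hη := continuous_eta β ω
    have hν := continuous_nu_s13 β ω
    have hν₀ := continuous_nu_s13 β u₀
    have hc : Continuous fun h : ℝ =>
        (eta β (a * h) ω + δ * nu β (a * h) ω) * nu β (a * h) u₀ := by fun_prop
    exact ((hc.tendsto 0).mono_left nhdsWithin_le_nhds).mul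
      ((hN _ _ _).add ((hN _ _ _).const_mul e))
  simp only [mul_zero, add_zero, sum_const_zero] at hlim
  refine hlim.congr fun h => ?_
  simp only [digitSum, Finset.sum_div, ← Finset.sum_sub_distrib]
  refine Finset.sum_congr rfl fun ω _ => Finset.sum_congr rfl fun u₀ _ => ?_
  ring

lemma digitSum_tendsto {a β δ e D M : ℝ} {q : ℝ → ℝ} {N J : ℝ → ℝ → ℝ → ℝ → ℝ}
    (hβ : 0 < β) (hD : 0 < D) (hq : Continuous q)
    (hN : ∀ s j σ, Tendsto (fun h => (N s j σ h - J s j σ h) / h ^ 2) (𝓝[>] 0) (𝓝 0))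
    (hJ : ∀ h, digitSum a β δ e J h = β * h ^ 2 * (M + h * q h)) :
    Tendsto (fun h => digitSum a β δ e N h / (β * h ^ 2 / (2 * D))) (𝓝[>] 0)
      (𝓝 (2 * D * M)) := by
  have hmain : Tendsto (fun h => 2 * D * (M + h * q h)) (𝓝[>] 0) (𝓝 (2 * D * M)) := by
    have hc : Continuous fun h => 2 * D * (M + h * q h) := by fun_prop
    simpa using (hc.tendsto 0).mono_left nhdsWithin_le_nhds
  have hrem := (tendsto_digitSum_sub (a := a) (β := β) (δ := δ) (e := e) hN).const_mul (2 * D / β)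
  have hsum := hrem.add hmain
  rw [mul_zero, zero_add] at hsum
  refine hsum.congr' ?_
  filter_upwards [self_mem_nhdsWithin] with h hh
  have hh' : h ≠ 0 := ne_of_gt hh
  rw [hJ]
  field_simp
  ring

lemma digitSum_jet_neg_one_one (a β f₀ : ℝ) (A : Fin 3 → ℝ) (B : Fin 3 → Fin 3 → ℝ)
    (c : Fin 2 → ℝ) (l : Fin 3 → ℝ) (h : ℝ) :
    digitSum a β 1 (-1) (jet f₀ A B c l) h =
      β * h ^ 2 * ((-2 * B 1 1 - 2 * B 0 1) + h * 0) := by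
  simp [digitSum, Fin.sum_univ_three, jet, eta, nu]
  ring

lemma digitSum_jet_neg_one (a β e f₀ : ℝ) (A : Fin 3 → ℝ) (B : Fin 3 → Fin 3 → ℝ)
    (c : Fin 2 → ℝ) (l : Fin 3 → ℝ) (h : ℝ) :
    digitSum a β (-1) e (jet f₀ A B c l) h =
      β * h ^ 2 * (-(a * (A 0 * (1 + e) + e * A 1)) + h * (-(a * ((1 + e) * l 0 + e * l 1 +
        β * a * h / 2 * ((1 + e) * B 0 2 + e * B 1 2))))) := by
  simp [digitSum, Fin.sum_univ_three, jet, eta, nu]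
  ring

lemma digitSum_jet_one_one (a β : ℝ) {f₀ : ℝ} {A : Fin 3 → ℝ} {B : Fin 3 → Fin 3 → ℝ}
    {c : Fin 2 → ℝ} {l : Fin 3 → ℝ} (hf₀ : f₀ = 0) (hA : A 1 = 0) (hB : B 1 1 = 0)
    (hc : c = 0) (hl : l 1 = 0) (h : ℝ) :
    digitSum a β 1 1 (jet f₀ A B c l) h =
      β * h ^ 2 * ((4 * B 0 0 + 2 * B 0 1 + 4 * B 2 2 + 2 * a * A 2) + h * (2 * a * l 2)) := by
  simp [digitSum, Fin.sum_univ_three, jet, eta, nu, hf₀, hA, hB, hc, hl]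
  ring

lemma eq_zero_of_tendsto_quadratic_div_sq {p q t : ℝ}
    (H : Tendsto (fun h : ℝ => (p + h * q + h ^ 2 * t) / h ^ 2) (𝓝[>] 0) (𝓝 0)) :
    p = 0 ∧ q = 0 ∧ t = 0 := by
  have hlim : ∀ g : ℝ → ℝ, Continuous g → Tendsto g (𝓝[>] 0) (𝓝 0) → g 0 = 0 := fun g hg h =>
    tendsto_nhds_unique ((hg.tendsto 0).mono_left nhdsWithin_le_nhds) h
  have hpow : ∀ n : ℕ, Tendsto (fun h : ℝ => h ^ n * ((p + h * q + h ^ 2 * t) / h ^ 2))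
      (𝓝[>] 0) (𝓝 0) := fun n => by
    simpa using (((continuous_pow n).tendsto (0 : ℝ)).mono_left nhdsWithin_le_nhds).mul H
  have hp : p = 0 := by
    have := hlim (fun h => p + h * q + h ^ 2 * t) (by fun_prop) ((hpow 2).congr' (by
      filter_upwards [self_mem_nhdsWithin] with h hh
      have hh' : h ≠ 0 := ne_of_gt hh
      field_simp))
    simpa using this
  have hq : q = 0 := by
    have := hlim (fun h => q + h * t) (by fun_prop) ((hpow 1).congr' (by
      filter_upwards [self_mem_nhdsWithin] with h hh
      have hh' : h ≠ 0 := ne_of_gt hh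
      rw [hp]
      field_simp
      ring))
    simpa using this
  refine ⟨hp, hq, hlim (fun _ => t) continuous_const (H.congr' ?_)⟩
  filter_upwards [self_mem_nhdsWithin] with h hh
  have hh' : h ≠ 0 := ne_of_gt hh
  rw [hp, hq]
  field_simp
  ring

lemma jet_coeff_eq_zero {f₀ : ℝ} {A : Fin 3 → ℝ} {B : Fin 3 → Fin 3 → ℝ} {c : Fin 2 → ℝ}
    {l : Fin 3 → ℝ}
    (H : ∀ j, Tendsto (fun h => (0 - jet f₀ A B c l 0 j 0 h) / h ^ 2) (𝓝[>] 0) (𝓝 0)) :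
    f₀ = 0 ∧ A 1 = 0 ∧ B 1 1 = 0 ∧ c = 0 ∧ l 1 = 0 := by
  have key : ∀ j, f₀ = 0 ∧ A 1 * j + c 0 = 0 ∧ B 1 1 * j ^ 2 + l 1 * j + c 1 = 0 := fun j =>
    eq_zero_of_tendsto_quadratic_div_sq <| by
      refine (neg_zero (G := ℝ) ▸ (H j).neg).congr fun h => ?_
      simp [jet]
      ring
  obtain ⟨h0, h1, h2⟩ := key 0
  obtain ⟨-, h3, h4⟩ := key 1
  obtain ⟨-, -, h5⟩ := key (-1)
  refine ⟨h0, by linarith, by linarith, ?_, by linarith⟩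
  ext i
  fin_cases i <;> simp <;> linarith

lemma avgA_eq_sum_digitSum {β : ℝ} (h0 : 0 < β) (h1 : β < 1) (D v r : ℝ) (k : ℕ) (ρ₀ : ℝ → ℝ)
    (f : ℝ → ℝ → ℝ) (ε δ : ℝ) (m : ℕ) {h : ℝ} (hh : h ≠ 0) :
    avgA D v β r k ρ₀ f ε δ m h = ∑ u : Fin (k - 1) → Fin 3, (∏ d, nu β (v / D * h) (u d)) *
      (digitSum (v / D) β δ (ε * (-1) ^ m)
        (fun s j σ h => pairField (v / D) r ρ₀ f u (h • (s, j, σ), h)) h /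
          (β * h ^ 2 / (2 * D))) := by
  have hPe : v * h / D = v / D * h := by ring
  unfold avgA Ksum
  rw [mul_comm h, mul_div_mul_right _ _ hh]
  simp only [Floc_eq_pairField h0 h1]
  simp only [hPe, digitSum]
  simp only [← mul_div_assoc, ← Finset.sum_div, Finset.mul_sum]
  congr 1
  symm
  rw [Finset.sum_comm]
  refine Finset.sum_congr rfl fun ω _ => ?_
  rw [Finset.sum_comm]
  refine Finset.sum_congr rfl fun u₀ _ => Finset.sum_congr rfl fun u _ => ?_
  push_cast
  ring

lemma tendsto_avgA {β : ℝ} (h0 : 0 < β) (h1 : β < 1) {D v r : ℝ} {k : ℕ} {ρ₀ : ℝ → ℝ}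
    {f : ℝ → ℝ → ℝ} {ε δ : ℝ} {m : ℕ} {L : ℝ}
    (H : ∀ u : Fin (k - 1) → Fin 3, Tendsto (fun h => digitSum (v / D) β δ (ε * (-1) ^ m)
      (fun s j σ h => pairField (v / D) r ρ₀ f u (h • (s, j, σ), h)) h / (β * h ^ 2 / (2 * D)))
      (𝓝[>] 0) (𝓝 L)) :
    Tendsto (fun h => avgA D v β r k ρ₀ f ε δ m h) (𝓝[>] 0) (𝓝 L) := by
  have hw : ∀ u : Fin (k - 1) → Fin 3, Tendsto (fun h => ∏ d, nu β (v / D * h) (u d))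
      (𝓝[>] 0) (𝓝 (∏ d, nu β (v / D * 0) (u d))) := fun u => by
    have hc : Continuous fun h => ∏ d, nu β (v / D * h) (u d) :=
      continuous_finsetProd _ fun d _ => (continuous_nu_s13 β (u d)).comp (by fun_prop)
    exact (hc.tendsto 0).mono_left nhdsWithin_le_nhds
  have hsum := tendsto_finsetSum univ fun u _ => (hw u).mul (H u)
  rw [← Finset.sum_mul, ← Fintype.piFinset_univ, Finset.sum_prod_piFinset univ
    (fun _ => nu β (v / D * 0))] at hsum
  simp only [sum_nu, prod_const_one, one_mul] at hsum
  refine hsum.congr' ?_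
  filter_upwards [self_mem_nhdsWithin] with h hh
  rw [avgA_eq_sum_digitSum h0 h1 D v r k ρ₀ f ε δ m (ne_of_gt hh), Fintype.piFinset_univ]

/-- β-independence of macroscopically observable limits: if the LOE exponent of
(m,ε,δ) equals 0 — i.e. (m = 0 and (ε,δ) ≠ (1,1)), or (m = 2 and ε = δ = 1), or
(m = 1 and (ε = −1 or δ = 1)) — then for every β ∈ (0,1) the continuum limit
lim_{Δr→0⁺} ⟨A⟩_β(Δr) exists and is the same real number for all β ∈ (0,1). -/
theorem beta_independence_of_observable_limit
    (D v r : ℝ) (k : ℕ) (ρ₀ : ℝ → ℝ) (f : ℝ → ℝ → ℝ)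
    (ε δ : ℝ) (m : ℕ) (Chat : ℝ → ℝ)
    (hD : 0 < D) (hk : 1 ≤ k)
    (hρ : ContDiff ℝ (⊤ : ℕ∞) ρ₀) (hρpos : ∀ x, 0 < ρ₀ x)
    (hf : ContDiff ℝ (⊤ : ℕ∞) (Function.uncurry f))
    (hε : ε = 1 ∨ ε = -1) (hδ : δ = 1 ∨ δ = -1)
    (hsym : ∀ x y, f y x = (-1 : ℝ) ^ m * f x y)
    (hlow : ∀ Y : ℝ, ∀ j < m, iteratedDeriv j (fun X => ftilde f X Y) 0 = 0)
    (hchar : ∀ Y : ℝ, iteratedDeriv m (fun X => ftilde f X Y) 0 = (m.factorial : ℝ) * Chat Y)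
    (hCbdd : ∃ M : ℝ, ∀ y, |Chat y| ≤ M) (hCne : ∀ y, Chat y ≠ 0)
    (hq : (m = 0 ∧ ¬(ε = 1 ∧ δ = 1)) ∨ (m = 2 ∧ ε = 1 ∧ δ = 1) ∨
      (m = 1 ∧ (ε = -1 ∨ δ = 1))) :
    ∃ L : ℝ, ∀ β : ℝ, 0 < β → β < 1 →
      Filter.Tendsto (fun Δr : ℝ => avgA D v β r k ρ₀ f ε δ m Δr)
        (nhdsWithin 0 (Set.Ioi 0)) (nhds L) := by
  obtain ⟨f₀, A, B, hAB⟩ := exists_jet_pairField (v / D) r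
    (hρ.of_le (WithTop.coe_le_coe.2 le_top)) (hf.of_le (WithTop.coe_le_coe.2 le_top)) (k - 1)
  choose c l hjet using hAB
  have hcases : (δ = 1 ∧ ε * (-1) ^ m = -1) ∨ δ = -1 ∨
      (δ = 1 ∧ ε * (-1) ^ m = 1 ∧ 0 < m) := by
    rcases hε with rfl | rfl <;> rcases hδ with rfl | rfl <;>
      rcases hq with ⟨rfl, h⟩ | ⟨rfl, h⟩ | ⟨rfl, h⟩ <;>
      first | (norm_num at h; done) | norm_num
  rcases hcases with ⟨rfl, he⟩ | rfl | ⟨rfl, he, hm⟩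
  · refine ⟨2 * D * (-2 * B 1 1 - 2 * B 0 1), fun β h0 h1 => tendsto_avgA h0 h1 fun u => ?_⟩
    rw [he]
    exact digitSum_tendsto h0 hD continuous_const (hjet u)
      (digitSum_jet_neg_one_one _ _ _ _ _ _ _)
  · refine ⟨2 * D * -(v / D * (A 0 * (1 + ε * (-1) ^ m) + ε * (-1) ^ m * A 1)),
      fun β h0 h1 => tendsto_avgA h0 h1 fun u => ?_⟩
    exact digitSum_tendsto h0 hD (by fun_prop) (hjet u) (digitSum_jet_neg_one _ _ _ _ _ _ _ _)
  · refine ⟨2 * D * (4 * B 0 0 + 2 * B 0 1 + 4 * B 2 2 + 2 * (v / D) * A 2),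
      fun β h0 h1 => tendsto_avgA h0 h1 fun u => ?_⟩
    have hdiag : ∀ x, f x x = 0 := fun x => by simpa [ftilde] using hlow x 0 hm
    obtain ⟨hf₀, hA, hB, hc, hl⟩ := jet_coeff_eq_zero (l := l u) (c := c u) fun j => by
      simpa only [pairField_diagonal _ _ _ hdiag] using hjet u 0 j 0
    rw [he]
    exact digitSum_tendsto h0 hD continuous_const (hjet u)
      (digitSum_jet_one_one _ _ hf₀ hA hB hc hl)
end
end
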